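/- arXiv:2505.12855 — 3 statements merged into one kernel-verified Lean document; each statement's English description precedes it below -/
import Mathlib

section
/- Let D be a division ring whose center F is infinite, and let w(x_1,…,x_m) be a non-trivial group word. If for every choice of invertible a_1,…,a_m ∈ D the value w(a_1,…,a_m) is algebraic over F of degree at most some fixed bound, then D is finite-dimensional over F. -/
section
open Polynomial TensorProduct

/-- generic alternating expression -/
def gAlt {R : Type*} [Ring R] (n : ℕ) (u : R) (y : Fin (n+1) → R) : R :=
  ∑ σ : Equiv.Perm (Fin (n+1)), (Equiv.Perm.sign σ : ℤˣ) •
    (List.ofFn fun i : Fin (n+1) => u ^ ((σ i : Fin (n+1)) : ℕ) * y i).prod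

theorem map_gAlt {R S : Type*} [Ring R] [Ring S] (f : R →+* S) (n : ℕ) (u : R)
    (y : Fin (n+1) → R) : f (gAlt n u y) = gAlt n (f u) (fun i => f (y i)) := by
  unfold gAlt
  rw [map_sum]
  refine Finset.sum_congr rfl fun σ _ => ?_
  rw [Units.smul_def, Units.smul_def, map_zsmul, map_list_prod, List.map_ofFn]
  congr 3
  funext i
  simp

theorem gAlt_eq_zero {F D : Type*} [Field F] [Ring D] [Algebra F D] (n : ℕ) (u : D)
    (y : Fin (n+1) → D) (p : F[X]) (hp : p ≠ 0) (hd : p.natDegree ≤ n) (hu : aeval u p = 0) :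
    gAlt n u y = 0 := by
  have hdep : ¬ LinearIndependent F (fun i : Fin (n+1) => u ^ (i : ℕ)) := by
    rw [Fintype.not_linearIndependent_iff]
    refine ⟨fun i => p.coeff i, ?_, ?_⟩
    · rw [aeval_eq_sum_range' (Nat.lt_succ_of_le hd)] at hu
      rw [← hu, Finset.sum_range]
    · refine ⟨⟨p.natDegree, Nat.lt_succ_of_le hd⟩, ?_⟩
      simpa using hp
  have := (MultilinearMap.alternatization ((MultilinearMap.mkPiAlgebraFin F (n+1) D).compLinearMap
    (fun i => LinearMap.mulRight F (y i)))).map_linearDependent _ hdep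
  rw [MultilinearMap.alternatization_apply] at this
  rw [← this]
  unfold gAlt
  refine Finset.sum_congr rfl fun σ _ => ?_
  simp [MultilinearMap.domDomCongr_apply]

/-! ### Ore condition for polynomials over a division ring -/

theorem ore_poly {D : Type*} [DivisionRing D] : ∀ (k : ℕ) (p q : D[X]), q ≠ 0 → q.natDegree ≤ k →
    ∃ r s : D[X], s ≠ 0 ∧ p * s = q * r := by
  intro k
  induction k with
  | zero =>
    intro p q hq hk
    have h := eq_C_of_natDegree_le_zero hk
    have h0 : q.coeff 0 ≠ 0 := fun h0 => hq (by rw [h, h0, C_0])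
    refine ⟨C (q.coeff 0)⁻¹ * p, 1, one_ne_zero, ?_⟩
    rw [h, ← mul_assoc, ← C_mul]
    simp [h0]
  | succ k ih =>
    intro p q hq hk
    have hl : q.leadingCoeff ≠ 0 := leadingCoeff_ne_zero.2 hq
    set m := q * C q.leadingCoeff⁻¹ with hm
    have hmon : m.Monic := monic_mul_leadingCoeff_inv hq
    have hdeg : m.natDegree = q.natDegree := natDegree_mul_leadingCoeff_inv _ hq
    have hdiv := modByMonic_add_div p m
    by_cases hr : p %ₘ m = 0
    · refine ⟨C q.leadingCoeff⁻¹ * (p /ₘ m), 1, one_ne_zero, ?_⟩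
      rw [hr, zero_add, hm, mul_assoc] at hdiv
      rw [← hm] at hdiv
      rw [mul_one]; exact hdiv.symm
    · by_cases hm1 : m = 1
      · refine ⟨C q.leadingCoeff⁻¹ * p, 1, one_ne_zero, ?_⟩
        rw [← mul_assoc, ← hm, hm1]; simp
      have hlt : (p %ₘ m).natDegree < m.natDegree := natDegree_modByMonic_lt p hmon hm1
      obtain ⟨v, u, hu, huv⟩ := ih q (p %ₘ m) hr (by omega)
      have hv : v ≠ 0 := by
        rintro rfl
        rw [mul_zero] at huv
        exact (mul_ne_zero hq hu) huv
      refine ⟨u + C q.leadingCoeff⁻¹ * (p /ₘ m) * v, v, hv, ?_⟩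
      conv_lhs => rw [← hdiv]
      rw [add_mul, ← huv, mul_add, hm]
      simp only [mul_assoc]

/-- evaluation at a central element as a ring hom -/
noncomputable def evC (F : Type*) {D : Type*} [Field F] [Ring D] [Algebra F D] (l : F) : D[X] →+* D :=
  eval₂RingHom' (RingHom.id D) (algebraMap F D l) (fun a => (Algebra.commutes l a).symm)

theorem evC_C {F D : Type*} [Field F] [Ring D] [Algebra F D] (l : F) (a : D) :
    evC F l (C a) = a :=
  (eval₂_C (RingHom.id D) _ : eval₂ (RingHom.id D) _ (C a) = _)

theorem evC_X {F D : Type*} [Field F] [Ring D] [Algebra F D] (l : F) :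
    evC F l (X : D[X]) = algebraMap F D l :=
  (eval₂_X (RingHom.id D) _ : eval₂ (RingHom.id D) _ X = _)

theorem evC_zero {F D : Type*} [Field F] [Ring D] [Algebra F D] (s : Set F) (hs : s.Infinite)
    (p : D[X]) (h : ∀ l ∈ s, evC F l p = 0) : p = 0 := by
  let b := Module.Basis.ofVectorSpace F D
  ext n
  rw [coeff_zero]
  apply b.repr.injective
  ext i
  rw [map_zero]
  let q : F[X] := p.sum fun k a => monomial k (b.repr a i)
  have hq : q = 0 := by
    apply Polynomial.eq_zero_of_infinite_isRoot
    refine hs.mono fun l hl => ?_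
    have h1 := h l hl
    change eval₂ (RingHom.id D) _ p = 0 at h1
    rw [eval₂_eq_sum, Polynomial.sum] at h1
    have h2 := congrArg (fun z => b.repr z i) h1
    simp only [map_sum, Finsupp.finsetSum_apply, map_zero] at h2
    change eval l q = 0
    simp only [q, Polynomial.sum, eval_finsetSum, eval_monomial]
    rw [Finsupp.zero_apply] at h2
    rw [← h2]
    refine Finset.sum_congr rfl fun k _ => ?_
    rw [← map_pow, ← Algebra.commutes, RingHom.id_apply, ← Algebra.smul_def, map_smul]
    simp [mul_comm]
  have h3 : q.coeff n = 0 := by rw [hq, coeff_zero]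
  simp only [q, Polynomial.sum, finsetSum_coeff, coeff_monomial] at h3
  simp at h3
  by_cases hc : p.coeff n = 0
  · simp [hc]
  · simpa [hc] using h3

/-- the unit `1 + x t` of the power series ring -/
noncomputable def su {R : Type*} [Ring R] (x : R) : (PowerSeries R)ˣ where
  val := 1 + PowerSeries.C x * PowerSeries.X
  inv := PowerSeries.invOfUnit (1 + PowerSeries.C x * PowerSeries.X) 1
  val_inv := PowerSeries.mul_invOfUnit _ _ (by simp)
  inv_val := PowerSeries.invOfUnit_mul _ _ (by simp)

theorem map_su {R S : Type*} [Ring R] [Ring S] (f : R →+* S) (x : R) :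
    Units.map (PowerSeries.map f : PowerSeries R →* PowerSeries S) (su x) = su (f x) := by
  ext1
  simp [su]

theorem map_lift {γ R S : Type*} [Ring R] [Ring S] (f : R →+* S) (U : γ → Rˣ) (v : FreeGroup γ) :
    f (FreeGroup.lift U v : Rˣ) =
      (FreeGroup.lift (fun g => Units.map (f : R →* S) (U g)) v : Sˣ) := by
  have : (Units.map (f : R →* S)).comp (FreeGroup.lift U) =
      FreeGroup.lift (fun g => Units.map (f : R →* S) (U g)) := by
    ext g; simp
  rw [← this]; rfl

/-- pairs (series, function) which are given by a common right fraction -/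
noncomputable def fracRing (F : Type*) {D : Type*} [Field F] [DivisionRing D] [Algebra F D]
    (s : Set F) : Subring (PowerSeries D × (s → D)) where
  carrier := {z | ∃ p q : D[X], q ≠ 0 ∧ z.1 * (q : PowerSeries D) = p ∧
    ∀ l : s, z.2 l * evC F (l : F) q = evC F (l : F) p}
  zero_mem' := ⟨0, 1, one_ne_zero, by simp, by simp⟩
  one_mem' := ⟨1, 1, one_ne_zero, by simp, by simp⟩
  neg_mem' := by
    rintro z ⟨p, q, hq, h1, h2⟩
    refine ⟨-p, q, hq, ?_, ?_⟩
    · rw [Prod.fst_neg, neg_mul, h1]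
      ext k; simp
    · intro l; simp [h2]
  add_mem' := by
    rintro z z' ⟨p, q, hq, h1, h2⟩ ⟨p', q', hq', h1', h2'⟩
    obtain ⟨r, s, hs, hrs⟩ := ore_poly _ q q' hq' le_rfl
    refine ⟨p * s + p' * r, q * s, mul_ne_zero hq hs, ?_, ?_⟩
    · rw [Prod.fst_add, add_mul]
      nth_rw 2 [hrs]
      rw [Polynomial.coe_mul, Polynomial.coe_mul, ← mul_assoc, ← mul_assoc, h1, h1']
      simp
    · intro l
      rw [Prod.snd_add, Pi.add_apply, add_mul]
      nth_rw 2 [hrs]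
      rw [map_mul, map_mul, ← mul_assoc, ← mul_assoc, h2, h2', map_add, map_mul, map_mul]
  mul_mem' := by
    rintro z z' ⟨p, q, hq, h1, h2⟩ ⟨p', q', hq', h1', h2'⟩
    obtain ⟨r, s, hs, hrs⟩ := ore_poly _ p' q hq le_rfl
    refine ⟨p * r, q' * s, mul_ne_zero hq' hs, ?_, ?_⟩
    · rw [Prod.fst_mul, Polynomial.coe_mul, mul_assoc, ← mul_assoc z'.1, h1', ← Polynomial.coe_mul,
        hrs, Polynomial.coe_mul, ← mul_assoc, h1, Polynomial.coe_mul]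
    · intro l
      rw [Prod.snd_mul, Pi.mul_apply, map_mul, mul_assoc, ← mul_assoc (z'.2 l), h2', ← map_mul,
        hrs, map_mul, ← mul_assoc, h2, map_mul]

theorem fracRing_zero {F D : Type*} [Field F] [DivisionRing D] [Algebra F D]
    (s : Set F) (hs : s.Infinite) (z : PowerSeries D × (s → D)) (hz : z ∈ fracRing F s)
    (h0 : z.2 = 0) : z.1 = 0 := by
  obtain ⟨p, q, hq, h1, h2⟩ := hz
  have hp : p = 0 := by
    apply evC_zero s hs
    intro l hl
    rw [← h2 ⟨l, hl⟩, h0]; simp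
  rw [hp, Polynomial.coe_zero] at h1
  rcases mul_eq_zero.1 h1 with h | h
  · exact h
  · exact absurd (Polynomial.coe_eq_zero_iff.1 h) hq

theorem series_identity {F D γ : Type*} [Field F] [Infinite F] [DivisionRing D] [Algebra F D]
    [Finite γ] (n : ℕ) (v : FreeGroup γ)
    (h : ∀ (U : γ → Dˣ) (y : Fin (n+1) → D), gAlt n ((FreeGroup.lift U v : Dˣ) : D) y = 0)
    (x : γ → D) (y : Fin (n+1) → D) :
    gAlt n ((FreeGroup.lift (fun g => su (x g)) v : (PowerSeries D)ˣ) : PowerSeries D)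
      (fun i => PowerSeries.C (y i)) = 0 := by
  classical
  let s : Set F := {l | ∀ g, 1 + x g * algebraMap F D l ≠ 0}
  have hs : s.Infinite := by
    have hfin : sᶜ.Finite := by
      have : sᶜ = ⋃ g, {l | 1 + x g * algebraMap F D l = 0} := by
        ext l; simp [s]
      rw [this]
      refine Set.finite_iUnion fun g => Set.Subsingleton.finite ?_
      intro a ha b hb
      simp only [Set.mem_ofPred_eq] at ha hb
      have hx : x g ≠ 0 := by intro hx; simp [hx] at ha
      have : x g * algebraMap F D a = x g * algebraMap F D b := by
        rw [← hb] at ha; exact add_left_cancel ha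
      exact (algebraMap F D).injective (mul_left_cancel₀ hx this)
    intro hsf
    exact Set.infinite_univ (α := F) (by rw [← Set.union_compl_self s]; exact hsf.union hfin)
  let Ul : s → γ → Dˣ := fun l g => Units.mk0 _ (l.2 g)
  let Up : γ → (s → D)ˣ := fun g => MulEquiv.piUnits.symm (fun l => Ul l g)
  let W : γ → (PowerSeries D × (s → D))ˣ := fun g => MulEquiv.prodUnits.symm (su (x g), Up g)
  have hW1 : ∀ g, ((W g : (PowerSeries D × (s → D))ˣ) : PowerSeries D × (s → D)).1 =
      1 + PowerSeries.C (x g) * PowerSeries.X := fun g => rfl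
  have hW2 : ∀ g l, ((W g : (PowerSeries D × (s → D))ˣ) : PowerSeries D × (s → D)).2 l =
      1 + x g * algebraMap F D l := fun g l => rfl
  have hWmem : ∀ g, ((W g : (PowerSeries D × (s → D))ˣ) : PowerSeries D × (s → D)) ∈ fracRing F s := by
    intro g
    refine ⟨1 + C (x g) * X, 1, one_ne_zero, ?_, ?_⟩
    · rw [hW1]; simp
    · intro l
      rw [hW2]; simp [evC_C, evC_X]
  have hWinv : ∀ g, (((W g)⁻¹ : (PowerSeries D × (s → D))ˣ) : PowerSeries D × (s → D)) ∈ fracRing F s := by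
    intro g
    have hne : (1 + C (x g) * X : D[X]) ≠ 0 := by
      intro h0
      have := congrArg (fun p => coeff p 0) h0
      simp at this
    refine ⟨1, 1 + C (x g) * X, hne, ?_, ?_⟩
    · have h1 : (((W g)⁻¹ : (PowerSeries D × (s → D))ˣ) * (W g : PowerSeries D × (s → D))).1 = 1 := by
        simp
      rw [Prod.fst_mul] at h1
      rw [hW1] at h1
      simpa using h1
    · intro l
      have h1 : (((W g)⁻¹ : (PowerSeries D × (s → D))ˣ) * (W g : PowerSeries D × (s → D))).2 l = 1 := by
        simp
      rw [Prod.snd_mul, Pi.mul_apply] at h1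
      rw [map_add, map_mul, evC_C, evC_X, map_one]
      exact h1
  have hmem : ∀ v : FreeGroup γ, ((FreeGroup.lift W v : (PowerSeries D × (s → D))ˣ) :
      PowerSeries D × (s → D)) ∈ fracRing F s := by
    intro v
    induction v using FreeGroup.induction_on with
    | C1 => simpa using (fracRing F s).one_mem
    | of g => simpa using hWmem g
    | inv_of g _ => simpa using hWinv g
    | mul a b ha hb => rw [map_mul, Units.val_mul]; exact (fracRing F s).mul_mem ha hb
  let Y : Fin (n+1) → PowerSeries D × (s → D) := fun i => (PowerSeries.C (y i), fun _ => y i)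
  have hY : ∀ i, Y i ∈ fracRing F s := fun i => ⟨C (y i), 1, one_ne_zero, by simp [Y], by simp [Y, evC_C]⟩
  have hG : gAlt n ((FreeGroup.lift W v : (PowerSeries D × (s → D))ˣ) :
      PowerSeries D × (s → D)) Y ∈ fracRing F s := by
    unfold gAlt
    refine Subring.sum_mem _ fun σ _ => ?_
    rw [Units.smul_def]
    refine Subring.zsmul_mem _ (Subring.list_prod_mem _ ?_) _
    intro z hz
    rw [List.mem_ofFn] at hz
    obtain ⟨i, rfl⟩ := hz
    exact (fracRing F s).mul_mem (pow_mem (hmem v) _) (hY i)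
  have := fracRing_zero s hs _ hG ?_
  · have h2 := map_gAlt (RingHom.fst (PowerSeries D) (s → D)) n
      ((FreeGroup.lift W v : (PowerSeries D × (s → D))ˣ) : PowerSeries D × (s → D)) Y
    rw [map_lift] at h2
    rw [RingHom.coe_fst, this] at h2
    rw [h2]
    rfl
  · funext l
    have h2 := map_gAlt ((Pi.evalRingHom (fun _ : s => D) l).comp
      (RingHom.snd (PowerSeries D) (s → D))) n
      ((FreeGroup.lift W v : (PowerSeries D × (s → D))ˣ) : PowerSeries D × (s → D)) Y
    rw [map_lift] at h2
    have h3 := h (Ul l) (fun i => y i)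
    refine Eq.trans h2 (Eq.trans ?_ h3)
    congr 3

/-- `f` vanishes under all evaluations in `R` -/
def IsPI {F X : Type*} [Field F] (f : FreeAlgebra F X) (R : Type*) [Ring R] [Algebra F R] : Prop :=
  ∀ φ : X → R, FreeAlgebra.lift F φ f = 0

theorem IsPI.hom {F X : Type*} [Field F] {f : FreeAlgebra F X} {R : Type*} [Ring R] [Algebra F R]
    (h : IsPI f R) (φ : FreeAlgebra F X →ₐ[F] R) : φ f = 0 := by
  have := h (fun x => φ (FreeAlgebra.ι F x))
  rwa [show FreeAlgebra.lift F (fun x => φ (FreeAlgebra.ι F x)) = φ from by ext x; simp] at this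

theorem IsPI.of_surj {F X : Type*} [Field F] {f : FreeAlgebra F X} {R S : Type*} [Ring R]
    [Algebra F R] [Ring S] [Algebra F S] (h : IsPI f R) (ψ : R →ₐ[F] S)
    (hψ : Function.Surjective ψ) : IsPI f S := by
  intro φ
  choose g hg using fun x => hψ (φ x)
  have h1 := h g
  have : FreeAlgebra.lift F φ = ψ.comp (FreeAlgebra.lift F g) := by ext x; simp [hg]
  rw [this, AlgHom.comp_apply, h1, map_zero]

theorem IsPI.tensor_poly {F X D σ : Type*} [Field F] [Infinite F] {f : FreeAlgebra F X} [Ring D]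
    [Algebra F D] (h : IsPI f D) : IsPI f (D ⊗[F] MvPolynomial σ F) := by
  classical
  intro φ
  set z := FreeAlgebra.lift F φ f with hz
  let ev : (σ → F) → (D ⊗[F] MvPolynomial σ F →ₐ[F] D) := fun l =>
    (Algebra.TensorProduct.rid F F D).toAlgHom.comp
      (Algebra.TensorProduct.map (AlgHom.id F D) (MvPolynomial.aeval l))
  have hev : ∀ l, ev l z = 0 := fun l => h.hom ((ev l).comp (FreeAlgebra.lift F φ))
  let b := Module.Basis.ofVectorSpace F D
  apply (TensorProduct.equivFinsuppOfBasisLeft (N := MvPolynomial σ F) b).injective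
  rw [map_zero]
  ext1 i
  rw [Finsupp.zero_apply]
  apply MvPolynomial.funext
  intro l
  rw [map_zero]
  have key : ∀ z : D ⊗[F] MvPolynomial σ F,
      MvPolynomial.eval l (TensorProduct.equivFinsuppOfBasisLeft b z i) = b.repr (ev l z) i := by
    intro z
    induction z using TensorProduct.induction_on with
    | zero => simp
    | add a c ha hc => simp only [map_add, Finsupp.add_apply, ha, hc]
    | tmul a c =>
      rw [TensorProduct.equivFinsuppOfBasisLeft_apply_tmul_apply]
      simp [ev, MvPolynomial.smul_eval, mul_comm]
  rw [key, hev, map_zero, Finsupp.zero_apply]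

theorem IsPI.tensor {F X D K : Type*} [Field F] [Infinite F] {f : FreeAlgebra F X} [Ring D]
    [Algebra F D] [CommRing K] [Algebra F K] (h : IsPI f D) : IsPI f (D ⊗[F] K) := by
  refine (h.tensor_poly (σ := K)).of_surj
    (Algebra.TensorProduct.map (AlgHom.id F D) (MvPolynomial.aeval (id : K → K))) ?_
  have : Function.Surjective (MvPolynomial.aeval (id : K → K) : MvPolynomial K F →ₐ[F] K) :=
    fun k => ⟨MvPolynomial.X k, by simp⟩
  exact TensorProduct.map_surjective Function.surjective_id this

theorem indep_sandwich {F D ι : Type*} [Field F] [DivisionRing D] [Algebra F D]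
    (hcenter : Set.range (algebraMap F D) = Set.center D) (b : ι → D)
    (hb : LinearIndependent F b) (s : Finset ι) : ∀ (k : ι → D),
    (∀ v, ∑ i ∈ s, b i * v * k i = 0) → ∀ i ∈ s, k i = 0 := by
  classical
  induction s using Finset.induction_on with
  | empty => simp
  | insert a s ha ih =>
    intro k hk
    by_cases h0 : k a = 0
    · have : ∀ i ∈ s, k i = 0 := by
        apply ih
        intro v
        have := hk v
        rw [Finset.sum_insert ha, h0, mul_zero, zero_add] at this
        exact this
      intro i hi
      rcases Finset.mem_insert.1 hi with rfl | hi
      · exact h0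
      · exact this i hi
    · exfalso
      let k' : ι → D := fun i => k i * (k a)⁻¹
      have hk' : ∀ v, ∑ i ∈ insert a s, b i * v * k' i = 0 := by
        intro v
        have := congrArg (· * (k a)⁻¹) (hk v)
        simpa [Finset.sum_mul, k', mul_assoc] using this
      have hka : k' a = 1 := mul_inv_cancel₀ h0
      have hcen : ∀ i ∈ s, ∃ l : F, algebraMap F D l = k' i := by
        intro i hi
        have : k' i ∈ Set.center D := by
          rw [Semigroup.mem_center_iff]
          intro c
          have h1 := ih (fun i => c * k' i - k' i * c) ?_ i hi
          · exact sub_eq_zero.1 h1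
          · intro v
            have e1 := hk' (v * c)
            have e2 := congrArg (· * c) (hk' v)
            simp only [zero_mul] at e2
            rw [Finset.sum_insert ha, hka] at e1 e2
            rw [add_mul, Finset.sum_mul] at e2
            have e3 := congrArg₂ (· - ·) e1 e2
            simp only [sub_self] at e3
            rw [← e3]
            simp only [mul_sub, Finset.sum_sub_distrib, mul_assoc, mul_one]
            abel
        rw [← hcenter] at this
        exact this
      choose! l hl using hcen
      have h1 := hk' 1
      rw [Finset.sum_insert ha, hka] at h1
      have h2 : ∑ i ∈ insert a s, (if i = a then 1 else l i) • b i = 0 := by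
        rw [Finset.sum_insert ha, ← h1]
        congr 1
        · simp
        · refine Finset.sum_congr rfl fun i hi => ?_
          have : i ≠ a := by rintro rfl; exact ha hi
          rw [if_neg this, Algebra.smul_def, Algebra.commutes, hl i hi, mul_one]
      have := linearIndependent_iff'.1 hb _ _ h2 a (Finset.mem_insert_self _ _)
      simp at this

theorem exists_maxComm (F D : Type*) [Field F] [Ring D] [Algebra F D] :
    ∃ K : Subalgebra F D, (∀ a ∈ K, ∀ b ∈ K, a * b = b * a) ∧
      ∀ c, (∀ a ∈ K, a * c = c * a) → c ∈ K := by
  obtain ⟨S, hS⟩ := zorn_subset {S : Set D | ∀ a ∈ S, ∀ b ∈ S, a * b = b * a} (by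
    intro c hc hch
    refine ⟨⋃₀ c, ?_, fun s hs => Set.subset_sUnion_of_mem hs⟩
    rintro a ⟨s, hs, has⟩ b ⟨t, ht, hbt⟩
    rcases hch.total hs ht with h | h
    · exact hc ht a (h has) b hbt
    · exact hc hs a has b (h hbt))
  have key : ∀ c, (∀ a ∈ S, a * c = c * a) → c ∈ S := by
    intro c hc
    have hm : insert c S ∈ {S : Set D | ∀ a ∈ S, ∀ b ∈ S, a * b = b * a} := by
      rintro a (rfl | ha) b (rfl | hb)
      · rfl
      · exact (hc b hb).symm
      · exact hc a ha
      · exact hS.1 a ha b hb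
    exact hS.2 hm (Set.subset_insert _ _) (Set.mem_insert _ _)
  have hmem : ∀ c, c ∈ Subalgebra.centralizer F S ↔ c ∈ S := by
    intro c
    rw [Subalgebra.mem_centralizer_iff]
    exact ⟨key c, fun hc a ha => hS.1 a ha c hc⟩
  refine ⟨Subalgebra.centralizer F S, ?_, ?_⟩
  · intro a ha b hb
    exact hS.1 a ((hmem a).1 ha) b ((hmem b).1 hb)
  · intro c hc
    exact (hmem c).2 (key c fun a ha => hc a ((hmem a).2 ha))

theorem simple_finite_index {R M ι : Type*} [Ring R] [AddCommGroup M] [Module R M]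
    [IsSimpleModule R M] [Module.Finite (Module.End R M) M] (t : Finset M)
    (v : ι → M → M) (hv : ∀ (s : Finset ι) (g : ι → Module.End R M),
      (∀ j ∈ t, ∑ i ∈ s, g i (v i j) = 0) → ∀ i ∈ s, g i = 0) : Finite ι := by
  classical
  have : LinearIndependent (Module.End R M) (fun i => (fun j : t => v i j) : ι → (t → M)) := by
    rw [linearIndependent_iff']
    intro s g hg
    refine hv s g fun j hj => ?_
    have := congrFun hg ⟨j, hj⟩
    rw [Finset.sum_apply] at this
    exact this
  exact this.finite

theorem simple_dense {R M : Type*} [Ring R] [AddCommGroup M] [Module R M]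
    [IsSimpleModule R M] (hfin : ¬ Module.Finite (Module.End R M) M) (N : ℕ) :
    ∃ v : Fin N → M, LinearIndependent (Module.End R M) v ∧
      ∀ y : Fin N → M, ∃ r : R, ∀ j, r • v j = y j := by
  classical
  obtain ⟨v, hv⟩ : ∃ v : Fin N → M, LinearIndependent (Module.End R M) v := by
    let B := Module.Basis.ofVectorSpace (Module.End R M) M
    have : Infinite (Module.Basis.ofVectorSpaceIndex (Module.End R M) M) := by
      by_contra hc
      rw [not_infinite_iff_finite] at hc
      exact hfin (Module.Finite.of_basis B)
    exact ⟨fun i => B (Infinite.natEmbedding _ i), B.linearIndependent.comp _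
      ((Infinite.natEmbedding _).injective.comp Fin.val_injective)⟩
  refine ⟨v, hv, fun y => ?_⟩
  obtain ⟨φ, hφ⟩ : ∃ φ : M →ₗ[Module.End R M] M, ∀ j, φ (v j) = y j := by
    obtain ⟨φ, hφ⟩ := LinearMap.exists_extend ((Module.Basis.span hv).constr ℕ y)
    refine ⟨φ, fun j => ?_⟩
    have h1 := LinearMap.congr_fun hφ (Module.Basis.span hv j)
    rw [Module.Basis.constr_basis] at h1
    rw [← h1]
    simp [Module.Basis.span_apply]
  obtain ⟨e, he⟩ := jacobson_density φ (Finset.univ.image v)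
  exact ⟨e, fun j => by rw [← he _ (by simp), hφ]⟩

theorem exists_envelope {F D : Type*} [Field F] [Infinite F] [Ring D] [Algebra F D]
    (K : Subalgebra F D) (hK : ∀ a ∈ K, ∀ b ∈ K, a * b = b * a) :
    ∃ S : Subalgebra F (Module.End F D),
      (∀ {X : Type*} (f : FreeAlgebra F X), IsPI f D → IsPI f S) ∧
      (∀ d : D, LinearMap.mulLeft F d ∈ S) ∧ (∀ k ∈ K, LinearMap.mulRight F k ∈ S) := by
  let _ : CommRing K := { (inferInstance : Ring K) with
    mul_comm := fun a b => Subtype.ext (hK a a.2 b b.2) }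
  let Rm : K →ₐ[F] Module.End F D := AlgHom.ofLinearMap
    { toFun := fun k => LinearMap.mulRight F (k : D)
      map_add' := fun a b => by ext v; simp [mul_add]
      map_smul' := fun a b => by ext v; simp }
    (by ext v; simp)
    (by intro a b; ext v; simp [mul_assoc, hK a a.2 b b.2])
  let Θ : D ⊗[F] K →ₐ[F] Module.End F D := Algebra.TensorProduct.lift (Algebra.lmul F D) Rm
    (fun a k => by ext v; simp [Rm, mul_assoc])
  have hΘ : ∀ (d : D) (k : K), Θ (d ⊗ₜ k) = Algebra.lmul F D d * Rm k := fun d k =>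
    Algebra.TensorProduct.lift_tmul ..
  refine ⟨Θ.range, fun f h => (h.tensor (K := K)).of_surj Θ.rangeRestrict
    Θ.rangeRestrict_surjective, fun d => ⟨d ⊗ₜ (1 : K), ?_⟩, fun k hk => ⟨1 ⊗ₜ (⟨k, hk⟩ : K), ?_⟩⟩
  · refine (hΘ _ _).trans ?_
    rw [map_one, mul_one]; rfl
  · refine (hΘ _ _).trans ?_
    rw [map_one, one_mul]; rfl

theorem envelope_dense {F D : Type*} [Field F] [DivisionRing D] [Algebra F D]
    (hcenter : Set.range (algebraMap F D) = Set.center D) (hinf : ¬ FiniteDimensional F D)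
    (K : Subalgebra F D) (hK : ∀ a ∈ K, ∀ b ∈ K, a * b = b * a)
    (hKmax : ∀ c, (∀ a ∈ K, a * c = c * a) → c ∈ K)
    (S : Subalgebra F (Module.End F D)) (hL : ∀ d : D, LinearMap.mulLeft F d ∈ S)
    (hR : ∀ k ∈ K, LinearMap.mulRight F k ∈ S) (N : ℕ) :
    ∃ v : Fin N → D, LinearIndependent F v ∧
      ∀ y : Fin N → D, ∃ e : S, ∀ j, (e : Module.End F D) (v j) = y j := by
  have : IsSimpleModule S D := by
    rw [isSimpleModule_iff_toSpanSingleton_surjective]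
    refine ⟨inferInstance, fun m hm d => ⟨⟨_, hL (d * m⁻¹)⟩, ?_⟩⟩
    change (d * m⁻¹) * m = d
    rw [mul_assoc, inv_mul_cancel₀ hm, mul_one]
  have hδ : ∀ (δ : Module.End S D) (x : D), δ x = x * δ 1 := by
    intro δ x
    have := δ.map_smul (⟨_, hL x⟩ : S) 1
    change δ (x * 1) = x * δ 1 at this
    rwa [mul_one] at this
  have hδK : ∀ (δ : Module.End S D), δ 1 ∈ K := by
    intro δ
    apply hKmax
    intro a ha
    have := δ.map_smul (⟨_, hR a ha⟩ : S) 1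
    change δ (1 * a) = δ 1 * a at this
    rw [one_mul, hδ] at this
    exact this
  have hninf : ¬ Module.Finite (Module.End S D) D := by
    intro hfin
    apply hinf
    obtain ⟨t, ht⟩ := hfin.fg_top
    let b := Module.Basis.ofVectorSpace F D
    have hli : ∀ (s : Finset _) (g : _ → Module.End S D),
        (∀ j ∈ t, ∑ i ∈ s, g i (b i * j) = 0) → ∀ i ∈ s, g i = 0 := by
      intro s g hg i hi
      have hg1 : g i 1 = 0 := by
        refine indep_sandwich hcenter b b.linearIndependent s (fun i => g i 1) ?_ i hi
        intro v
        have hv : v ∈ Submodule.span (Module.End S D) (t : Set D) := by rw [ht]; trivial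
        induction hv using Submodule.span_induction with
        | mem x hx =>
          refine Eq.trans ?_ (hg x hx)
          refine Finset.sum_congr rfl fun i _ => ?_
          exact (hδ (g i) _).symm
        | zero => simp
        | add x y _ _ hx hy =>
          simp only [mul_add, add_mul, Finset.sum_add_distrib, hx, hy, add_zero]
        | smul δ x _ hx =>
          have := congrArg (· * δ 1) hx
          simp only [zero_mul, Finset.sum_mul] at this
          rw [← this]
          refine Finset.sum_congr rfl fun i _ => ?_
          rw [Module.End.smul_def, hδ δ x]
          simp only [mul_assoc]
          rw [hK _ (hδK δ) _ (hδK (g i))]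
      ext x
      rw [hδ, hg1]; simp
    have hfi := simple_finite_index (R := S) t (fun i j => b i * j) hli
    exact Module.Finite.of_basis b
  obtain ⟨v, hv, hdn⟩ := simple_dense (R := S) (M := D) hninf N
  have hvF : LinearIndependent F v := by
    rw [Fintype.linearIndependent_iff]
    intro g hg i
    have := Fintype.linearIndependent_iff.1 hv (fun i => algebraMap F (Module.End S D) (g i)) (by
      rw [← hg]
      refine Finset.sum_congr rfl fun i _ => ?_
      simp) i
    have := congrArg (fun δ : Module.End S D => δ 1) this
    simpa using this
  exact ⟨v, hvF, hdn⟩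

theorem IsPI.matrix {F X D : Type*} [Field F] [Infinite F] [DivisionRing D] [Algebra F D]
    (hcenter : Set.range (algebraMap F D) = Set.center D) (hinf : ¬ FiniteDimensional F D)
    {f : FreeAlgebra F X} (h : IsPI f D) (N : ℕ) : IsPI f (Matrix (Fin N) (Fin N) F) := by
  obtain ⟨K, hK, hKmax⟩ := exists_maxComm F D
  obtain ⟨S, hS, hL, hR⟩ := exists_envelope K hK
  obtain ⟨v, hvF, hdn⟩ := envelope_dense hcenter hinf K hK hKmax S hL hR N
  have hPI := hS f h
  intro T
  have hdens : ∀ x, ∃ e : S, ∀ j, (e : Module.End F D) (v j) = ∑ i, T x i j • v i :=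
    fun x => hdn _
  choose e he using hdens
  have h0 := hPI e
  have key : ∀ a : FreeAlgebra F X, ∀ j, (FreeAlgebra.lift F e a : Module.End F D) (v j) =
      ∑ i, (FreeAlgebra.lift F T a) i j • v i := by
    intro a
    induction a using FreeAlgebra.induction with
    | grade0 r =>
      intro j
      simp [Matrix.algebraMap_matrix_apply]
    | grade1 x => intro j; simpa using he x j
    | add a b ha hb =>
      intro j
      simp only [map_add, add_smul, Subalgebra.coe_add, LinearMap.add_apply, ha, hb,
        Matrix.add_apply, Finset.sum_add_distrib]
    | mul a b ha hb =>
      intro j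
      rw [map_mul, map_mul, Subalgebra.coe_mul, Module.End.mul_apply, hb, map_sum]
      simp_rw [map_smul, ha, Matrix.mul_apply, Finset.sum_smul, Finset.smul_sum, smul_smul]
      rw [Finset.sum_comm]
      refine Finset.sum_congr rfl fun i _ => Finset.sum_congr rfl fun k _ => ?_
      rw [mul_comm]
  ext i j
  have h1 := key f j
  rw [h0, Subalgebra.coe_zero, LinearMap.zero_apply] at h1
  exact Fintype.linearIndependent_iff.1 hvF (fun i => FreeAlgebra.lift F T f i j) h1.symm i

/-- the generic series -/
noncomputable def genSer (F : Type*) [Field F] {γ : Type*} (n : ℕ) (v : FreeGroup γ) :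
    PowerSeries (FreeAlgebra F (γ ⊕ Fin (n+1))) :=
  gAlt n ((FreeGroup.lift
    (fun g => su (FreeAlgebra.ι F (Sum.inl g) : FreeAlgebra F (γ ⊕ Fin (n+1)))) v :
      (PowerSeries (FreeAlgebra F (γ ⊕ Fin (n+1))))ˣ) :
      PowerSeries (FreeAlgebra F (γ ⊕ Fin (n+1))))
      (fun i => PowerSeries.C (FreeAlgebra.ι F (Sum.inr i) : FreeAlgebra F (γ ⊕ Fin (n+1))))

theorem genSer_map (F : Type*) [Field F] {γ : Type*} (n : ℕ) (v : FreeGroup γ)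
    {R : Type*} [Ring R] [Algebra F R] (φ : γ ⊕ Fin (n+1) → R) :
      PowerSeries.map (FreeAlgebra.lift F φ : FreeAlgebra F (γ ⊕ Fin (n+1)) →+* R)
        (genSer F n v) =
      gAlt n ((FreeGroup.lift (fun g => su (φ (Sum.inl g))) v : (PowerSeries R)ˣ) : PowerSeries R)
        (fun i => PowerSeries.C (φ (Sum.inr i))) := by
  have e : ∀ z, (FreeAlgebra.lift F φ : FreeAlgebra F (γ ⊕ Fin (n+1)) →+* R)
      (FreeAlgebra.ι F z) = φ z := fun z => FreeAlgebra.lift_ι_apply _ _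
  unfold genSer
  rw [map_gAlt, map_lift]
  simp_rw [map_su, PowerSeries.map_C]
  congr 3
  · congr 1
    funext g
    exact congrArg su (e _)
  · funext i
    exact congrArg _ (e _)

theorem matrix_series_identity {F D γ : Type*} [Field F] [Infinite F] [DivisionRing D] [Algebra F D]
    (hcenter : Set.range (algebraMap F D) = Set.center D) (hinf : ¬ FiniteDimensional F D)
    [Finite γ] (n : ℕ) (v : FreeGroup γ)
    (h : ∀ (U : γ → Dˣ) (y : Fin (n+1) → D), gAlt n ((FreeGroup.lift U v : Dˣ) : D) y = 0)
    (N : ℕ) (x : γ → Matrix (Fin N) (Fin N) F) (y : Fin (n+1) → Matrix (Fin N) (Fin N) F) :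
    gAlt n ((FreeGroup.lift (fun g => su (x g)) v : (PowerSeries (Matrix (Fin N) (Fin N) F))ˣ) :
      PowerSeries (Matrix (Fin N) (Fin N) F)) (fun i => PowerSeries.C (y i)) = 0 := by
  have hPI : ∀ j, IsPI (PowerSeries.coeff j (genSer F n v)) D := by
    intro j φ
    have h1 := genSer_map F n v φ
    rw [series_identity (F := F) n v h] at h1
    have h2 := congrArg (PowerSeries.coeff j) h1
    rw [PowerSeries.coeff_map, map_zero] at h2
    exact h2
  have hPM := fun j => (hPI j).matrix hcenter hinf N
  have h3 := genSer_map F n v (Sum.elim x y)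
  simp only [Sum.elim_inl, Sum.elim_inr] at h3
  rw [← h3]
  ext1 j
  rw [PowerSeries.coeff_map, map_zero]
  exact hPM j (Sum.elim x y)

/-- the unit `1 + x` for square zero `x` -/
def squ {R : Type*} [Ring R] (x : R) (hx : x * x = 0) : Rˣ where
  val := 1 + x
  inv := 1 - x
  val_inv := by rw [add_mul, mul_sub, mul_sub, hx]; simp
  inv_val := by rw [sub_mul, mul_add, mul_add, hx]; simp

theorem map_squ {R S : Type*} [Ring R] [Ring S] (f : R →+* S) (x : R) (hx : x * x = 0) :
    Units.map (f : R →* S) (squ x hx) = squ (f x) (by rw [← map_mul, hx, map_zero]) := by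
  ext1
  simp [squ]

theorem square_zero_identity {R γ : Type*} [Ring R] (n : ℕ) (v : FreeGroup γ) (x : γ → R)
    (hx : ∀ g, x g * x g = 0) (y : Fin (n+1) → R)
    (h : gAlt n ((FreeGroup.lift (fun g => su (x g)) v : (PowerSeries R)ˣ) : PowerSeries R)
      (fun i => PowerSeries.C (y i)) = 0) :
    gAlt n ((FreeGroup.lift (fun g => squ (x g) (hx g)) v : Rˣ) : R) y = 0 := by
  have hx' : ∀ g, (C (x g) * X : R[X]) * (C (x g) * X) = 0 := by
    intro g
    rw [mul_assoc, ← mul_assoc X, X_mul_C, mul_assoc, ← mul_assoc, ← C_mul, hx, C_0, zero_mul]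
  let G : R[X] := gAlt n ((FreeGroup.lift (fun g => squ (C (x g) * X) (hx' g)) v : R[X]ˣ) : R[X])
    (fun i => C (y i))
  have hG : G = 0 := by
    apply Polynomial.coe_injective
    rw [Polynomial.coe_zero, ← h]
    change Polynomial.coeToPowerSeries.ringHom G = _
    simp only [G]
    rw [map_gAlt, map_lift]
    simp_rw [map_squ]
    congr 3
    · congr 1
      funext g
      ext1
      simp [su, squ]
    · funext i
      simp
  let ev : R[X] →+* R := eval₂RingHom' (RingHom.id R) 1 (fun a => Commute.one_right a)
  have evC : ∀ a, ev (C a) = a := fun a => (eval₂_C (RingHom.id R) _ : eval₂ (RingHom.id R) _ (C a) = _)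
  have evX : ev X = 1 := (eval₂_X (RingHom.id R) _ : eval₂ (RingHom.id R) _ X = _)
  have h2 : ev G = 0 := by rw [hG, map_zero]
  simp only [G] at h2
  rw [map_gAlt, map_lift] at h2
  simp_rw [map_squ, map_mul, evC, evX, mul_one] at h2
  exact h2

/-- the shift type matrix attached to a letter -/
def shiftM (F : Type*) [Field F] {γ : Type*} [DecidableEq γ] (c : ℕ → γ) (N : ℕ) (g : γ) :
    Matrix (Fin N) (Fin N) F :=
  Matrix.of fun i j => if (j : ℕ) = i + 1 ∧ c i = g then 1 else 0

theorem shiftM_sq {F : Type*} [Field F] {γ : Type*} [DecidableEq γ] (c : ℕ → γ)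
    (hc : ∀ j, c j ≠ c (j + 1)) (N : ℕ) (g : γ) : shiftM F c N g * shiftM F c N g = 0 := by
  ext i j
  rw [Matrix.mul_apply, Matrix.zero_apply]
  refine Finset.sum_eq_zero fun k _ => ?_
  simp only [shiftM, Matrix.of_apply]
  by_cases h1 : (k : ℕ) = i + 1 ∧ c i = g
  · by_cases h2 : (j : ℕ) = k + 1 ∧ c k = g
    · exfalso
      apply hc i
      rw [h1.2, ← h1.1, h2.2]
    · rw [if_neg h2, mul_zero]
  · rw [if_neg h1, zero_mul]

/-- row vector with leading position `k` -/
def Lead {F : Type*} [Field F] {N : ℕ} (k : ℕ) (ρ : Fin N → F) : Prop :=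
  ∀ q : Fin N, ((q : ℕ) = k → ρ q ≠ 0) ∧ (k < q → ρ q = 0)

theorem lead_step {F : Type*} [Field F] {γ : Type*} [DecidableEq γ] (c : ℕ → γ) (N : ℕ) (k : ℕ)
    (ρ : Fin N → F) (hρ : Lead k ρ) (e : F) (he : e ≠ 0) :
    Lead (k + 1) (Matrix.vecMul ρ (1 + e • shiftM F c N (c k))) := by
  have hform : ∀ q : Fin N, (k + 1 ≤ q) → Matrix.vecMul ρ (1 + e • shiftM F c N (c k)) q =
      ∑ i, ρ i * (e * (if (q : ℕ) = i + 1 ∧ c i = c k then 1 else 0)) := by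
    intro q hq
    rw [Matrix.vecMul_add, Matrix.vecMul_one, Pi.add_apply, (hρ q).2 (by omega), zero_add]
    rfl
  intro q
  constructor
  · intro hq
    rw [hform q (by omega)]
    have hk : k < N := by omega
    rw [Finset.sum_eq_single (⟨k, hk⟩ : Fin N)]
    · simp only [hq, true_and]
      rw [if_pos trivial, mul_one]
      exact mul_ne_zero ((hρ ⟨k, hk⟩).1 rfl) he
    · intro i _ hi
      rw [if_neg, mul_zero, mul_zero]
      rintro ⟨h1, _⟩
      exact hi (Fin.ext (by simp; omega))
    · simp
  · intro hq
    rw [hform q (by omega)]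
    refine Finset.sum_eq_zero fun i _ => ?_
    by_cases hi : (q : ℕ) = i + 1
    · rw [(hρ i).2 (by omega), zero_mul]
    · rw [if_neg (fun h => hi h.1), mul_zero, mul_zero]

theorem lead_list {F : Type*} [Field F] {γ : Type*} [DecidableEq γ] (c : ℕ → γ)
    (hc : ∀ j, c j ≠ c (j + 1)) (N : ℕ) (Q : List (γ × Bool)) :
    ∀ (k : ℕ) (ρ : Fin N → F) (_ : Lead k ρ) (_ : ∀ j (hj : j < Q.length), Q[j].1 = c (k + j)),
    Lead (k + Q.length) (Matrix.vecMul ρ ((FreeGroup.lift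
      (fun g => squ (shiftM F c N g) (shiftM_sq c hc N g)) (FreeGroup.mk Q) :
        (Matrix (Fin N) (Fin N) F)ˣ) : Matrix (Fin N) (Fin N) F)) := by
  induction Q with
  | nil =>
    intro k ρ hρ _
    simpa [FreeGroup.lift_mk] using hρ
  | cons a Q ih =>
    intro k ρ hρ hQ
    have h0 : a.1 = c k := hQ 0 (by simp)
    have e : FreeGroup.lift (fun g => squ (shiftM F c N g) (shiftM_sq c hc N g))
        (FreeGroup.mk (a :: Q)) = (cond a.2 (squ (shiftM F c N a.1) (shiftM_sq c hc N a.1))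
      (squ (shiftM F c N a.1) (shiftM_sq c hc N a.1))⁻¹) *
        FreeGroup.lift (fun g => squ (shiftM F c N g) (shiftM_sq c hc N g)) (FreeGroup.mk Q) := by
      rw [FreeGroup.lift_mk, FreeGroup.lift_mk, List.map_cons, List.prod_cons]
    rw [e, Units.val_mul, ← Matrix.vecMul_vecMul]
    have := ih (k + 1) (Matrix.vecMul ρ ((cond a.2 (squ (shiftM F c N a.1) (shiftM_sq c hc N a.1))
      (squ (shiftM F c N a.1) (shiftM_sq c hc N a.1))⁻¹ : (Matrix (Fin N) (Fin N) F)ˣ) :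
        Matrix (Fin N) (Fin N) F)) ?_ ?_
    · rw [List.length_cons, show k + (Q.length + 1) = k + 1 + Q.length by ring]
      exact this
    · rw [h0]
      cases a.2
      · have := lead_step c N k ρ hρ (-1) (by simp)
        rw [neg_one_smul, ← sub_eq_add_neg] at this
        exact this
      · have := lead_step c N k ρ hρ 1 one_ne_zero
        rw [one_smul] at this
        exact this
    · intro j hj
      have := hQ (j + 1) (by simpa using hj)
      rw [show k + 1 + j = k + (j + 1) by ring, ← this]
      simp

theorem gAlt_matrix_ne {F : Type*} [Field F] (n N : ℕ) [NeZero N]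
    (u : Matrix (Fin N) (Fin N) F) (q : Fin (n+1) → Fin N)
    (h1 : ∀ i : Fin (n+1), (u ^ (i : ℕ)) 0 (q i) ≠ 0)
    (h2 : ∀ i j : Fin (n+1), i < j → (u ^ (i : ℕ)) 0 (q j) = 0) :
    gAlt n u (fun i => Matrix.single (q i) (0 : Fin N) (1 : F)) ≠ 0 := by
  have hprod : ∀ (k : ℕ) (A : Fin k → Matrix (Fin N) (Fin N) F) (p : Fin k → Fin N),
      ((List.ofFn fun i => A i * Matrix.single (p i) (0 : Fin N) (1 : F)).prod :
        Matrix (Fin N) (Fin N) F) 0 0 = ∏ i, A i 0 (p i) := by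
    intro k
    induction k with
    | zero => intro A p; simp [Matrix.one_apply]
    | succ k ih =>
      intro A p
      rw [List.ofFn_succ, List.prod_cons, Fin.prod_univ_succ, ← ih, Matrix.mul_apply,
        Finset.sum_eq_single 0]
      · simp
      · intro b _ hb
        rw [Matrix.mul_single_apply_of_ne _ _ _ _ _ hb, zero_mul]
      · simp
  have hdet : (gAlt n u (fun i => Matrix.single (q i) (0 : Fin N) (1 : F)) : Matrix (Fin N) (Fin N) F) 0 0 =
      (Matrix.of fun i j : Fin (n+1) => (u ^ (i : ℕ)) 0 (q j)).det := by
    rw [Matrix.det_apply, gAlt, Matrix.sum_apply]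
    refine Finset.sum_congr rfl fun σ _ => ?_
    rw [Units.smul_def, Units.smul_def, Matrix.smul_apply, hprod]
    rfl
  intro h0
  rw [h0, Matrix.det_of_lowerTriangular] at hdet
  · rw [Matrix.zero_apply] at hdet
    exact Finset.prod_ne_zero_iff.2 (fun i _ => h1 i) hdet.symm
  · intro i j hij
    exact h2 i j (by simpa using hij)

/-- dbl a letter into two letters -/
def dbl {α : Type*} (a : α × Bool) : List ((α × Bool) × Bool) :=
  [((a.1, !a.2), a.2), ((a.1, a.2), a.2)]

theorem length_expand {α : Type*} (L : List (α × Bool)) :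
    (L.flatMap dbl).length = 2 * L.length := by
  induction L with
  | nil => simp
  | cons a L ih =>
    rw [List.flatMap_cons, List.length_append, ih]
    simp [dbl]
    ring

theorem lift_expand {α H : Type*} [Group H] (U : α × Bool → H) (L : List (α × Bool)) :
    FreeGroup.lift (fun i => U (i, false) * U (i, true)) (FreeGroup.mk L) =
      FreeGroup.lift U (FreeGroup.mk (L.flatMap dbl)) := by
  induction L with
  | nil => simp [FreeGroup.lift_mk]
  | cons a L ih =>
    rw [FreeGroup.lift_mk] at ih ⊢
    rw [FreeGroup.lift_mk] at ih ⊢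
    rw [List.map_cons, List.prod_cons, ih, List.flatMap_cons, List.map_append, List.prod_append]
    congr 1
    obtain ⟨i, b⟩ := a
    cases b <;> simp [dbl]

theorem expand_get {α : Type*} (L : List (α × Bool)) : ∀ (j : ℕ) (hj : j < L.length)
    (h0 : 2 * j < (L.flatMap dbl).length) (h1 : 2 * j + 1 < (L.flatMap dbl).length),
    (L.flatMap dbl)[2 * j].1 = (L[j].1, !L[j].2) ∧ (L.flatMap dbl)[2 * j + 1].1 = L[j] := by
  induction L with
  | nil => intro j hj; simp at hj
  | cons a L ih =>
    intro j hj h0 h1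
    cases j with
    | zero => exact ⟨rfl, rfl⟩
    | succ j =>
      have hj' : j < L.length := by simpa using hj
      have hl := length_expand L
      exact ih j hj' (by omega) (by omega)

/-- the sequence of generators -/
def genSeq {α : Type*} (L : List (α × Bool)) (hL : 0 < L.length) (j : ℕ) : α × Bool :=
  if j % 2 = 0 then
    ((L[(j / 2) % L.length]'(Nat.mod_lt _ hL)).1, !(L[(j / 2) % L.length]'(Nat.mod_lt _ hL)).2)
  else L[(j / 2) % L.length]'(Nat.mod_lt _ hL)

theorem genSeq_ne {α : Type*} (L : List (α × Bool)) (hL : 0 < L.length)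
    (hcyc : FreeGroup.IsCyclicallyReduced L) (j : ℕ) :
    genSeq L hL j ≠ genSeq L hL (j + 1) := by
  obtain ⟨t, rfl | rfl⟩ := Nat.even_or_odd' j
  · have e1 : (2 * t) % 2 = 0 := by omega
    have e2 : (2 * t + 1) % 2 ≠ 0 := by omega
    have e3 : (2 * t) / 2 = t := by omega
    have e4 : (2 * t + 1) / 2 = t := by omega
    unfold genSeq
    rw [if_pos e1, if_neg e2]
    simp only [e3, e4]
    intro h
    have := congrArg Prod.snd h
    simp at this
  · have e1 : (2 * t + 1 + 1) % 2 = 0 := by omega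
    have e2 : (2 * t + 1) % 2 ≠ 0 := by omega
    have e3 : (2 * t + 1 + 1) / 2 = t + 1 := by omega
    have e4 : (2 * t + 1) / 2 = t := by omega
    unfold genSeq
    rw [if_pos e1, if_neg e2]
    simp only [e3, e4]
    have key : (L[t % L.length]'(Nat.mod_lt _ hL)).1 = (L[(t + 1) % L.length]'(Nat.mod_lt _ hL)).1 →
        (L[t % L.length]'(Nat.mod_lt _ hL)).2 = (L[(t + 1) % L.length]'(Nat.mod_lt _ hL)).2 := by
      have hlt := Nat.mod_lt t hL
      by_cases hs : t % L.length + 1 < L.length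
      · have e : (t + 1) % L.length = t % L.length + 1 := by
          rw [← Nat.mod_add_mod, Nat.mod_eq_of_lt hs]
        simp only [e]
        exact List.isChain_iff_getElem.1 hcyc.1 _ hs
      · have e5 : t % L.length = L.length - 1 := by omega
        have e : (t + 1) % L.length = 0 := by
          rw [← Nat.mod_add_mod, e5, Nat.sub_add_cancel hL, Nat.mod_self]
        simp only [e, e5]
        refine hcyc.2 _ ?_ _ ?_
        · rw [List.getLast?_eq_getElem?]
          simp [hL]
        · rw [List.head?_eq_getElem?]
          simp [hL]
    intro h
    have h1 := congrArg Prod.fst h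
    have h2 := congrArg Prod.snd h
    have h3 := key h1
    simp only at h2
    rw [h3] at h2
    simp at h2

theorem expand_genSeq {α : Type*} (L : List (α × Bool)) (hL : 0 < L.length) (i j : ℕ)
    (hj : j < (L.flatMap dbl).length) :
    (L.flatMap dbl)[j].1 = genSeq L hL (2 * L.length * i + j) := by
  have hl := length_expand L
  obtain ⟨t, rfl | rfl⟩ := Nat.even_or_odd' j
  · have ht : t < L.length := by omega
    rw [(expand_get L t ht hj (by omega)).1]
    have e0 : 2 * L.length * i + 2 * t = 2 * (t + L.length * i) := by ring
    have e1 : (2 * L.length * i + 2 * t) % 2 = 0 := by omega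
    have e2 : (2 * L.length * i + 2 * t) / 2 % L.length = t := by
      rw [e0, Nat.mul_div_cancel_left _ (by norm_num), Nat.add_mul_mod_self_left,
        Nat.mod_eq_of_lt ht]
    unfold genSeq
    rw [if_pos e1]
    simp only [e2]
  · have ht : t < L.length := by omega
    rw [(expand_get L t ht (by omega) hj).2]
    have e0 : 2 * L.length * i + (2 * t + 1) = 2 * (t + L.length * i) + 1 := by ring
    have e1 : (2 * L.length * i + (2 * t + 1)) % 2 ≠ 0 := by omega
    have e2 : (2 * L.length * i + (2 * t + 1)) / 2 % L.length = t := by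
      rw [e0, show (2 * (t + L.length * i) + 1) / 2 = t + L.length * i by omega,
        Nat.add_mul_mod_self_left, Nat.mod_eq_of_lt ht]
    unfold genSeq
    rw [if_neg e1]
    simp only [e2]

theorem aeval_conj_zero {F D : Type*} [Field F] [Ring D] [Algebra F D] (g : Dˣ) (a : D)
    (p : F[X]) (h : aeval a p = 0) : aeval ((g⁻¹ : Dˣ) * a * g) p = 0 := by
  have hpow : ∀ k : ℕ, (((g⁻¹ : Dˣ) : D) * a * g) ^ k = ((g⁻¹ : Dˣ) : D) * a ^ k * g := by
    intro k
    exact Units.conj_pow' g a k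
  rw [aeval_eq_sum_range] at h ⊢
  simp_rw [hpow]
  have : ∀ k, p.coeff k • (((g⁻¹ : Dˣ) : D) * a ^ k * g) =
      ((g⁻¹ : Dˣ) : D) * (p.coeff k • a ^ k) * g := by
    intro k
    rw [mul_smul_comm, smul_mul_assoc]
  simp_rw [this]
  rw [← Finset.sum_mul, ← Finset.mul_sum, h, mul_zero, zero_mul]

theorem main_aux {F D α : Type*} [Field F] [Infinite F] [DivisionRing D] [Algebra F D]
    (hcenter : Set.range (algebraMap F D) = Set.center D) [Finite α]
    (L : List (α × Bool)) (hL : 0 < L.length) (hcyc : FreeGroup.IsCyclicallyReduced L)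
    (d : ℕ) (halg : ∀ a : α → Dˣ, ∃ p : F[X], p ≠ 0 ∧ p.natDegree ≤ d ∧
      aeval ((FreeGroup.lift a (FreeGroup.mk L) : Dˣ) : D) p = 0) :
    FiniteDimensional F D := by
  classical
  by_contra hinf
  have h : ∀ (U : α × Bool → Dˣ) (y : Fin (d+1) → D),
      gAlt d ((FreeGroup.lift U (FreeGroup.mk (L.flatMap dbl)) : Dˣ) : D) y = 0 := by
    intro U y
    obtain ⟨p, hp, hd, hu⟩ := halg (fun i => U (i, false) * U (i, true))
    rw [lift_expand] at hu
    exact gAlt_eq_zero d _ y p hp hd hu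
  set r := 2 * L.length with hr
  let N := r * d + 1
  have hc := genSeq_ne L hL hcyc
  let u : Matrix (Fin N) (Fin N) F := ((FreeGroup.lift
      (fun g => squ (shiftM F (genSeq L hL) N g) (shiftM_sq (genSeq L hL) hc N g))
      (FreeGroup.mk (L.flatMap dbl)) : (Matrix (Fin N) (Fin N) F)ˣ) : Matrix (Fin N) (Fin N) F)
  have hlead : ∀ i : ℕ, Lead (r * i) (Matrix.vecMul (Pi.single (0 : Fin N) (1 : F)) (u ^ i)) := by
    intro i
    induction i with
    | zero =>
      rw [pow_zero, Matrix.vecMul_one, mul_zero]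
      intro q
      constructor
      · intro hq
        have : q = 0 := Fin.ext (by simpa using hq)
        rw [this]
        simp
      · intro hq
        have : q ≠ 0 := by
          rintro rfl
          simp at hq
        simp [this]
    | succ i ih =>
      rw [pow_succ, ← Matrix.vecMul_vecMul]
      have := lead_list (genSeq L hL) hc N (L.flatMap dbl) (r * i) _ ih
        (fun j hj => expand_genSeq L hL i j hj)
      rw [length_expand] at this
      exact this
  let q : Fin (d+1) → Fin N := fun i => ⟨r * i, by
    have : (i : ℕ) ≤ d := by omega
    have := Nat.mul_le_mul_left r this
    omega⟩
  have hrow : ∀ (i : ℕ) (k : Fin N),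
      Matrix.vecMul (Pi.single (0 : Fin N) (1 : F)) (u ^ i) k = (u ^ i) 0 k := by
    intro i k
    rw [Matrix.single_one_vecMul]
    rfl
  refine gAlt_matrix_ne d N u q ?_ ?_ ?_
  · intro i
    rw [← hrow]
    exact (hlead i (q i)).1 rfl
  · intro i j hij
    rw [← hrow]
    refine (hlead i (q j)).2 ?_
    exact Nat.mul_lt_mul_of_pos_left hij (by omega)
  · exact square_zero_identity d _ (fun g => shiftM F (genSeq L hL) N g)
      (fun g => shiftM_sq (genSeq L hL) hc N g) _
      (matrix_series_identity hcenter hinf d _ h N _ _)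

end

/-- Let `D` be a division ring whose center `F` is infinite, and let `w(x_1,…,x_m)` be a
non-trivial group word. If for every choice of invertible `a_1,…,a_m ∈ D` the value
`w(a_1,…,a_m)` is algebraic over `F` of degree at most some fixed bound, then `D` is
finite-dimensional over `F`. -/
theorem finiteDimensional_of_word_algebraic_bounded
    {F D : Type*} [Field F] [Infinite F] [DivisionRing D] [Algebra F D]
    (hcenter : Set.range (algebraMap F D) = Set.center D)
    {m : ℕ} (w : FreeGroup (Fin m)) (hw : w ≠ 1)
    (halg : ∃ d : ℕ, ∀ a : Fin m → Dˣ,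
      ∃ p : Polynomial F, p ≠ 0 ∧ p.natDegree ≤ d ∧
        Polynomial.aeval ((FreeGroup.lift a w : Dˣ) : D) p = 0) :
    FiniteDimensional F D := by
  obtain ⟨d, halg⟩ := halg
  have hcyc : FreeGroup.IsCyclicallyReduced (FreeGroup.reduceCyclically w.toWord) :=
    FreeGroup.reduceCyclically.isCyclicallyReduced FreeGroup.isReduced_toWord
  have hconj := FreeGroup.reduceCyclically.conj_conjugator_reduceCyclically w.toWord
  generalize FreeGroup.reduceCyclically w.toWord = L at hcyc hconj
  generalize FreeGroup.reduceCyclically.conjugator w.toWord = C at hconj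
  have hwL : w = FreeGroup.mk C * FreeGroup.mk L * (FreeGroup.mk C)⁻¹ := by
    rw [FreeGroup.inv_mk, FreeGroup.mul_mk, FreeGroup.mul_mk, hconj, FreeGroup.mk_toWord]
  have hL : 0 < L.length := by
    rw [List.length_pos_iff]
    rintro rfl
    apply hw
    rw [hwL, ← FreeGroup.one_eq_mk, mul_one, mul_inv_cancel]
  refine main_aux hcenter L hL hcyc d ?_
  intro a
  obtain ⟨p, hp, hd, hz⟩ := halg a
  refine ⟨p, hp, hd, ?_⟩
  have := aeval_conj_zero (FreeGroup.lift a (FreeGroup.mk C)) _ p hz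
  rw [← Units.val_mul, ← Units.val_mul] at this
  have e : (FreeGroup.lift a (FreeGroup.mk C))⁻¹ * FreeGroup.lift a w *
      FreeGroup.lift a (FreeGroup.mk C) = FreeGroup.lift a (FreeGroup.mk L) := by
    rw [hwL]
    simp only [map_mul, map_inv]
    group
  rw [e] at this
  exact this
end

section
/- Let F be an algebraically closed field, let w(x_1,…,x_n) be a non-trivial group word, and let Q_m be the block-diagonal matrix defined below. Then there exist matrices S_1,…,S_n ∈ SL_m(F) such that w(S_1,…,S_n) = Q_m. -/
/-- The diagonal matrix `Q_m = diag(b_1, b_1⁻¹, …, b_s, b_s⁻¹)` (with an extra `1×1` block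
equal to `1` when `m` is odd), where `s = ⌊m/2⌋`. -/
def Qmat {F : Type*} [Field F] (m : ℕ) (b : Fin (m / 2) → F) :
    Matrix (Fin m) (Fin m) F :=
  Matrix.diagonal fun i =>
    if h : i.val / 2 < m / 2 then
      if i.val % 2 = 0 then b ⟨i.val / 2, h⟩ else (b ⟨i.val / 2, h⟩)⁻¹
    else 1

/-- letter matrix -/
noncomputable def letterMat {F : Type*} [Field F] (a c : F) : Matrix (Fin 2) (Fin 2) (Polynomial F) :=
  !![Polynomial.C ((c - a)⁻¹ * c) * Polynomial.X + Polynomial.C ((c - a)⁻¹ * (c + a)),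
     Polynomial.C (-(c - a)⁻¹) * Polynomial.X + Polynomial.C ((c - a)⁻¹ * (-2));
     Polynomial.C ((c - a)⁻¹ * (a * c)) * Polynomial.X + Polynomial.C ((c - a)⁻¹ * (c ^ 2 + a ^ 2)),
     Polynomial.C (-((c - a)⁻¹ * a)) * Polynomial.X + Polynomial.C (-((c - a)⁻¹ * (c + a)))]

lemma letterMat_det {F : Type*} [Field F] {a c : F} (h : a ≠ c) : (letterMat a c).det = 1 := by
  have h' : (c - a) ≠ 0 := sub_ne_zero.mpr h.symm
  obtain ⟨d, hd⟩ : ∃ d, d = (c - a)⁻¹ := ⟨_, rfl⟩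
  have h1 : d * (c - a) = 1 := by rw [hd]; exact inv_mul_cancel₀ h'
  have h2 : Polynomial.C d * (Polynomial.C c - Polynomial.C a) = 1 := by
    rw [← Polynomial.C_sub, ← Polynomial.C_mul, h1, Polynomial.C_1]
  rw [Matrix.det_fin_two]
  simp only [letterMat, ← hd, Matrix.of_apply, Matrix.cons_val', Matrix.cons_val_zero,
    Matrix.cons_val_one, Matrix.cons_val_fin_one, map_mul, map_add, map_neg, map_pow, map_ofNat]
  linear_combination (Polynomial.C d * (Polynomial.C c - Polynomial.C a) + 1) * h2

lemma letterMat_adj {F : Type*} [Field F] (a c : F) :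
    (letterMat a c).adjugate = letterMat c a := by
  have h1 : (a - c)⁻¹ = - (c - a)⁻¹ := by rw [← inv_neg, neg_sub]
  rw [Matrix.adjugate_fin_two]
  ext i j : 2
  fin_cases i <;> fin_cases j <;>
    simp only [letterMat, h1, Matrix.of_apply, Matrix.cons_val', Matrix.cons_val_zero,
    Matrix.cons_val_one, Matrix.cons_val_fin_one, map_mul, map_add, map_neg, map_pow, map_ofNat,
    Fin.zero_eta, Fin.mk_one] <;> ring_nf

lemma letterMat_deg {F : Type*} [Field F] (a c : F) (i j : Fin 2) :
    (letterMat a c i j).natDegree ≤ 1 := by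
  fin_cases i <;> fin_cases j <;> simp only [letterMat] <;> exact Polynomial.natDegree_linear_le

lemma letterMat_coeff {F : Type*} [Field F] (a c : F) (i j : Fin 2) :
    (letterMat a c i j).coeff 1 = (c - a)⁻¹ * (![1, a] i * ![c, -1] j) := by
  fin_cases i <;> fin_cases j <;>
    simp only [letterMat, Matrix.of_apply, Matrix.cons_val', Matrix.cons_val_zero,
    Matrix.cons_val_one, Matrix.cons_val_fin_one, Fin.zero_eta, Fin.mk_one,
    Polynomial.coeff_add, Polynomial.coeff_C_mul, Polynomial.coeff_X_one,
    Polynomial.coeff_C_of_ne_zero one_ne_zero] <;> ring_nf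

lemma prod_coeff {F ι : Type*} [Field F] (a : ι × Bool → F) (ha : Function.Injective a)
    (L : List (ι × Bool)) : ∀ x : ι × Bool, FreeGroup.IsReduced (x :: L) →
    ∃ k : F, k ≠ 0 ∧ ∀ i j : Fin 2,
      (((x :: L).map fun y => letterMat (a y) (a (y.1, !y.2))).prod i j).natDegree ≤ L.length + 1 ∧
      (((x :: L).map fun y => letterMat (a y) (a (y.1, !y.2))).prod i j).coeff (L.length + 1) =
        k * (![1, a x] i * ![a (((x :: L).getLast (by simp)).1, !((x :: L).getLast (by simp)).2), -1] j) := by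
  have hne : ∀ y : ι × Bool, a (y.1, !y.2) - a y ≠ 0 := by
    intro y h
    have := congrArg Prod.snd (ha (sub_eq_zero.mp h))
    simp at this
  induction L with
  | nil =>
    intro x _
    refine ⟨_, inv_ne_zero (hne x), fun i j => ?_⟩
    simp only [List.map_cons, List.map_nil, List.prod_cons, List.prod_nil, mul_one,
      List.length_nil, zero_add, List.getLast_singleton]
    exact ⟨letterMat_deg _ _ _ _, letterMat_coeff _ _ _ _⟩
  | cons y L ih =>
    intro x hx
    rw [FreeGroup.isReduced_cons_cons] at hx
    obtain ⟨k, hk, H⟩ := ih y hx.2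
    have hxy : a (x.1, !x.2) - a y ≠ 0 := by
      intro h
      have := ha (sub_eq_zero.mp h)
      have h1 := congrArg Prod.fst this
      have h2 := congrArg Prod.snd this
      simp only at h1 h2
      have := hx.1 h1
      rw [← h2] at this
      simp at this
    refine ⟨(a (x.1, !x.2) - a x)⁻¹ * (a (x.1, !x.2) - a y) * k,
      mul_ne_zero (mul_ne_zero (inv_ne_zero (hne x)) hxy) hk, fun i j => ?_⟩
    rw [List.map_cons, List.prod_cons, Matrix.mul_apply, Fin.sum_univ_two, List.length_cons]
    have e : L.length + 1 + 1 = 1 + (L.length + 1) := by ring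
    rw [e]
    constructor
    · apply (Polynomial.natDegree_add_le _ _).trans
      apply max_le <;>
      exact Polynomial.natDegree_mul_le.trans (add_le_add (letterMat_deg _ _ _ _) (H _ _).1)
    · rw [Polynomial.coeff_add,
        Polynomial.coeff_mul_add_eq_of_natDegree_le (letterMat_deg _ _ _ _) (H _ _).1,
        Polynomial.coeff_mul_add_eq_of_natDegree_le (letterMat_deg _ _ _ _) (H _ _).1,
        (H _ _).2, (H _ _).2, letterMat_coeff, letterMat_coeff]
      rw [List.getLast_cons (by simp : y :: L ≠ [])]
      simp only [Matrix.cons_val_zero, Matrix.cons_val_one, Matrix.cons_val_fin_one]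
      ring

lemma exists_trace {F : Type*} [Field F] [IsAlgClosed F] {n : ℕ} (w : FreeGroup (Fin n))
    (hw : w ≠ 1) (τ : F) : ∃ S : Fin n → Matrix.SpecialLinearGroup (Fin 2) F,
      (FreeGroup.lift S w : Matrix (Fin 2) (Fin 2) F).trace = τ := by
  obtain ⟨a, ha⟩ : ∃ a : Fin n × Bool → F, Function.Injective a :=
    ⟨fun x => Infinite.natEmbedding F (Encodable.encode x),
      (Infinite.natEmbedding F).injective.comp Encodable.encode_injective⟩
  have hne : ∀ y : Fin n × Bool, a y ≠ a (y.1, !y.2) := by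
    intro y h
    have := congrArg Prod.snd (ha h)
    simp at this
  let T : Fin n → Matrix.SpecialLinearGroup (Fin 2) (Polynomial F) := fun i =>
    ⟨letterMat (a (i, true)) (a (i, false)), letterMat_det (hne (i, true))⟩
  have hT : ∀ L : List (Fin n × Bool), ((FreeGroup.lift T (FreeGroup.mk L) :
      Matrix.SpecialLinearGroup (Fin 2) (Polynomial F)) : Matrix (Fin 2) (Fin 2) (Polynomial F)) =
      (L.map fun y => letterMat (a y) (a (y.1, !y.2))).prod := by
    intro L
    rw [FreeGroup.lift_mk]
    induction L with
    | nil => simp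
    | cons y L ih =>
      rw [List.map_cons, List.prod_cons, Matrix.SpecialLinearGroup.coe_mul, ih, List.map_cons,
        List.prod_cons]
      congr 1
      obtain ⟨i, _ | _⟩ := y
      · change ((T i)⁻¹ : Matrix.SpecialLinearGroup (Fin 2) (Polynomial F)).1 = _
        rw [Matrix.SpecialLinearGroup.coe_inv]
        exact letterMat_adj _ _
      · rfl
  have hred := FreeGroup.reduceCyclically.isCyclicallyReduced (FreeGroup.isReduced_toWord (x := w))
  have hconj := FreeGroup.reduceCyclically.conj_conjugator_reduceCyclically w.toWord
  generalize FreeGroup.reduceCyclically w.toWord = R at hred hconj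
  generalize FreeGroup.reduceCyclically.conjugator w.toWord = K at hconj
  have hwe : w = FreeGroup.mk K * FreeGroup.mk R * (FreeGroup.mk K)⁻¹ := by
    rw [FreeGroup.inv_mk, FreeGroup.mul_mk, FreeGroup.mul_mk, hconj, FreeGroup.mk_toWord]
  have htr : ((FreeGroup.lift T w : Matrix.SpecialLinearGroup (Fin 2) (Polynomial F)) :
      Matrix (Fin 2) (Fin 2) (Polynomial F)).trace =
      (R.map fun y => letterMat (a y) (a (y.1, !y.2))).prod.trace := by
    rw [← hT, hwe, map_mul, map_mul, Matrix.SpecialLinearGroup.coe_mul, Matrix.trace_mul_comm,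
      ← Matrix.SpecialLinearGroup.coe_mul, map_inv, ← mul_assoc, inv_mul_cancel, one_mul]
  cases R with
  | nil =>
    exfalso
    apply hw
    rw [hwe, ← FreeGroup.one_eq_mk, mul_one, mul_inv_cancel]
  | cons x L =>
    obtain ⟨k, hk, H⟩ := prod_coeff a ha L x hred.1
    generalize hP : ((x :: L).map fun y => letterMat (a y) (a (y.1, !y.2))).prod = P at H htr
    obtain ⟨z, hz⟩ : ∃ z, z = (x :: L).getLast (by simp) := ⟨_, rfl⟩
    rw [← hz] at H
    have hzx : a (z.1, !z.2) - a x ≠ 0 := by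
      intro h
      have h0 := ha (sub_eq_zero.mp h)
      have h1 := congrArg Prod.fst h0
      have h2 := congrArg Prod.snd h0
      simp only at h1 h2
      have := hred.2 z (by rw [hz, List.getLast?_eq_some_getLast (by simp)]; rfl) x (by simp) h1
      rw [← h2] at this
      simp at this
    have hc : P.trace.coeff (L.length + 1) ≠ 0 := by
      rw [Matrix.trace_fin_two, Polynomial.coeff_add, (H 0 0).2, (H 1 1).2]
      simp only [Matrix.cons_val_zero, Matrix.cons_val_one, Matrix.cons_val_fin_one]
      have : k * (1 * a (z.1, !z.2)) + k * (a x * -1) = k * (a (z.1, !z.2) - a x) := by ring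
      rw [this]
      exact mul_ne_zero hk hzx
    have hdeg : (P.trace - Polynomial.C τ).degree ≠ 0 := by
      intro h
      have h1 : (P.trace - Polynomial.C τ).coeff (L.length + 1) ≠ 0 := by
        rw [Polynomial.coeff_sub, Polynomial.coeff_C_of_ne_zero (by omega), sub_zero]
        exact hc
      exact h1 (Polynomial.coeff_eq_zero_of_degree_lt (by rw [h]; exact_mod_cast Nat.succ_pos _))
    obtain ⟨t, ht⟩ := IsAlgClosed.exists_root _ hdeg
    have ht' : P.trace.eval t = τ := by
      have := ht
      simp only [Polynomial.IsRoot, Polynomial.eval_sub, Polynomial.eval_C] at this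
      exact sub_eq_zero.mp this
    refine ⟨fun i => Matrix.SpecialLinearGroup.map (Polynomial.evalRingHom t) (T i), ?_⟩
    have := FreeGroup.lift_unique (f := fun i =>
      Matrix.SpecialLinearGroup.map (Polynomial.evalRingHom t) (T i))
      ((Matrix.SpecialLinearGroup.map (Polynomial.evalRingHom t)).comp (FreeGroup.lift T))
      (by intro x; simp) (x := w)
    rw [← this, MonoidHom.comp_apply, ← ht', ← htr, Matrix.trace_fin_two, Matrix.trace_fin_two,
      Polynomial.eval_add]
    rfl

lemma exists_diag {F : Type*} [Field F] [IsAlgClosed F] {n : ℕ} (w : FreeGroup (Fin n))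
    (hw : w ≠ 1) (b : F) (hb0 : b ≠ 0) (hb1 : b ^ 2 ≠ 1) :
    ∃ S : Fin n → Matrix.SpecialLinearGroup (Fin 2) F,
      ((FreeGroup.lift S w : Matrix.SpecialLinearGroup (Fin 2) F) : Matrix (Fin 2) (Fin 2) F) =
        Matrix.diagonal ![b, b⁻¹] := by
  obtain ⟨S, hS⟩ := exists_trace w hw (b + b⁻¹)
  generalize hM : FreeGroup.lift S w = M at hS
  have hbb : b - b⁻¹ ≠ 0 := by
    intro h
    apply hb1
    field_simp at h
    linear_combination h
  have hdet := M.det_coe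
  rw [Matrix.det_fin_two] at hdet
  rw [Matrix.trace_fin_two] at hS
  have key : ∀ c d : F, c * d = 1 → c + d = b + b⁻¹ →
      ∃ v ≠ 0, (M : Matrix (Fin 2) (Fin 2) F).mulVec v = c • v := by
    intro c d hcd hs
    obtain ⟨v, hv, h⟩ := (Matrix.exists_mulVec_eq_zero_iff
      (M := (M : Matrix (Fin 2) (Fin 2) F) - Matrix.scalar (Fin 2) c)).mpr (by
        rw [Matrix.det_fin_two]
        simp
        linear_combination hdet - c * hS + c * hs - hcd)
    refine ⟨v, hv, ?_⟩
    rw [Matrix.sub_mulVec, sub_eq_zero] at h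
    rw [h]
    ext i
    simp
  obtain ⟨u, hu, hMu⟩ := key b b⁻¹ (mul_inv_cancel₀ hb0) rfl
  obtain ⟨v, hv, hMv⟩ := key b⁻¹ b (inv_mul_cancel₀ hb0) (add_comm _ _)
  have u0 := congrFun hMu 0
  have u1 := congrFun hMu 1
  have v0 := congrFun hMv 0
  have v1 := congrFun hMv 1
  simp only [Matrix.mulVec, dotProduct, Fin.sum_univ_two, Pi.smul_apply, smul_eq_mul]
    at u0 u1 v0 v1
  have hD : u 0 * v 1 - v 0 * u 1 ≠ 0 := by
    intro hD
    -- otherwise `u` and `v` are proportional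
    obtain ⟨r, hr, h⟩ := (Matrix.exists_mulVec_eq_zero_iff
      (M := !![u 0, v 0; u 1, v 1])).mpr (by rw [Matrix.det_fin_two]; simpa using hD)
    have h0 := congrFun h 0
    have h1 := congrFun h 1
    simp [Matrix.mulVec, dotProduct, Fin.sum_univ_two] at h0 h1
    have hr0 : r 0 = 0 := by
      by_contra hr0
      apply hu
      ext i
      fin_cases i
      · have : (b - b⁻¹) * r 0 * u 0 = 0 := by
          linear_combination (M 0 0 - b⁻¹) * h0 + M 0 1 * h1 - r 0 * u0 - r 1 * v0
        simpa [hbb, hr0] using this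
      · have : (b - b⁻¹) * r 0 * u 1 = 0 := by
          linear_combination M 1 0 * h0 + (M 1 1 - b⁻¹) * h1 - r 0 * u1 - r 1 * v1
        simpa [hbb, hr0] using this
    have hr1 : r 1 ≠ 0 := by
      intro hr1
      apply hr
      ext i
      fin_cases i
      · exact hr0
      · exact hr1
    apply hv
    ext i
    fin_cases i
    · simpa [hr0, hr1] using h0
    · simpa [hr0, hr1] using h1
  obtain ⟨D, hDdef⟩ : ∃ D, D = u 0 * v 1 - v 0 * u 1 := ⟨_, rfl⟩
  rw [← hDdef] at hD
  let P : Matrix.SpecialLinearGroup (Fin 2) F := ⟨!![D⁻¹ * u 0, v 0; D⁻¹ * u 1, v 1], by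
    rw [Matrix.det_fin_two]
    simp
    field_simp
    rw [hDdef]⟩
  let Q : Matrix.SpecialLinearGroup (Fin 2) F := ⟨Matrix.diagonal ![b, b⁻¹], by
    simp [Matrix.det_diagonal, Fin.prod_univ_two, hb0]⟩
  have hMP : M * P = P * Q := by
    ext i j
    rw [Matrix.SpecialLinearGroup.coe_mul, Matrix.SpecialLinearGroup.coe_mul, Matrix.mul_apply,
      Matrix.mul_apply, Fin.sum_univ_two, Fin.sum_univ_two]
    fin_cases i <;> fin_cases j <;> simp [P, Q]
    · linear_combination D⁻¹ * u0
    · linear_combination v0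
    · linear_combination D⁻¹ * u1
    · linear_combination v1
  refine ⟨fun i => P⁻¹ * S i * P, ?_⟩
  have := FreeGroup.lift_unique (f := fun i => P⁻¹ * S i * P)
      ((MulAut.conj P⁻¹).toMonoidHom.comp (FreeGroup.lift S))
      (by intro x; simp) (x := w)
  rw [← this, MonoidHom.comp_apply, hM]
  have e : (MulAut.conj P⁻¹).toMonoidHom M = Q := by
    simp [mul_assoc, hMP]
  rw [e]

/-- index equivalence -/
def idxEquiv (m : ℕ) : (Fin 2 × Fin (m / 2)) ⊕ Fin (m % 2) ≃ Fin m :=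
  (Equiv.sumCongr ((Equiv.prodComm _ _).trans finProdFinEquiv) (Equiv.refl _)).trans
    (finSumFinEquiv.trans (finCongr (by omega)))

/-- block embedding of a family of 2 by 2 matrices -/
def blockHom (F : Type*) [Field F] (m : ℕ) :
    (Fin (m / 2) → Matrix.SpecialLinearGroup (Fin 2) F) →*
      Matrix.SpecialLinearGroup (Fin m) F where
  toFun g := ⟨(Matrix.fromBlocks (Matrix.blockDiagonal fun k => (g k : Matrix (Fin 2) (Fin 2) F))
      0 0 1).submatrix (idxEquiv m).symm (idxEquiv m).symm, by
    rw [Matrix.det_submatrix_equiv_self, Matrix.det_fromBlocks_zero₂₁, Matrix.det_blockDiagonal]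
    simp⟩
  map_one' := by
    apply Subtype.ext
    have : (fun _ : Fin (m / 2) => (1 : Matrix (Fin 2) (Fin 2) F)) = 1 := rfl
    simp [this]
  map_mul' g h := by
    apply Subtype.ext
    change Matrix.submatrix (Matrix.fromBlocks (Matrix.blockDiagonal fun k =>
      (g k : Matrix (Fin 2) (Fin 2) F) * (h k : Matrix (Fin 2) (Fin 2) F)) 0 0 1) _ _ =
      (Matrix.fromBlocks (Matrix.blockDiagonal fun k => (g k : Matrix (Fin 2) (Fin 2) F))
        0 0 1).submatrix (idxEquiv m).symm (idxEquiv m).symm *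
      (Matrix.fromBlocks (Matrix.blockDiagonal fun k => (h k : Matrix (Fin 2) (Fin 2) F))
        0 0 1).submatrix (idxEquiv m).symm (idxEquiv m).symm
    rw [Matrix.submatrix_mul_equiv, Matrix.fromBlocks_multiply, Matrix.blockDiagonal_mul]
    simp


/-- Let `F` be an algebraically closed field and `w(x_1,…,x_n)` a non-trivial group word.
Then the matrix `Q_m` is a value of the word map `w` on `SL_m(F)`. -/
theorem Qmat_mem_image_of_word
    {F : Type*} [Field F] [IsAlgClosed F]
    {n : ℕ} (w : FreeGroup (Fin n)) (hw : w ≠ 1)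
    (m : ℕ) (hm : 2 ≤ m) (b : Fin (m / 2) → F)
    (hb0 : ∀ i, b i ≠ 0) (hb1 : ∀ i, (b i) ^ 2 ≠ 1)
    (hb : ∀ i j, i ≠ j → b i ≠ b j ∧ b i ≠ (b j)⁻¹) :
    ∃ S : Fin n → Matrix.SpecialLinearGroup (Fin m) F,
      ((FreeGroup.lift S w : Matrix.SpecialLinearGroup (Fin m) F) :
        Matrix (Fin m) (Fin m) F) = Qmat m b := by
  choose T hT using fun k => exists_diag w hw (b k) (hb0 k) (hb1 k)
  refine ⟨fun i => blockHom F m fun k => T k i, ?_⟩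
  have h1 := FreeGroup.lift_unique (f := fun i => blockHom F m fun k => T k i)
      ((blockHom F m).comp (FreeGroup.lift fun i k => T k i))
      (by intro x; simp) (x := w)
  have h2 : ∀ k, (FreeGroup.lift (fun i k => T k i) w :
      Fin (m / 2) → Matrix.SpecialLinearGroup (Fin 2) F) k = FreeGroup.lift (T k) w := fun k =>
    FreeGroup.lift_unique (f := T k) ((Pi.evalMonoidHom _ k).comp
      (FreeGroup.lift fun i k => T k i)) (by intro x; simp) (x := w)
  rw [← h1, MonoidHom.comp_apply]
  change (Matrix.fromBlocks (Matrix.blockDiagonal fun k =>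
    ((FreeGroup.lift (fun i k => T k i) w :
      Fin (m / 2) → Matrix.SpecialLinearGroup (Fin 2) F) k : Matrix (Fin 2) (Fin 2) F))
      0 0 1).submatrix (idxEquiv m).symm (idxEquiv m).symm = _
  simp only [h2, hT]
  rw [Matrix.blockDiagonal_diagonal, ← Matrix.diagonal_one, Matrix.fromBlocks_diagonal,
    Matrix.submatrix_diagonal_equiv, Qmat]
  congr 1
  ext i
  obtain ⟨j, rfl⟩ := (idxEquiv m).surjective i
  rw [Function.comp_apply, Equiv.symm_apply_apply]
  rcases j with ⟨e, k⟩ | r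
  · have hv : (idxEquiv m (Sum.inl (e, k))).val = e.val + 2 * k.val := by
      simp [idxEquiv, finProdFinEquiv]
    have hk := k.2
    have he := e.2
    have hdiv : (idxEquiv m (Sum.inl (e, k))).val / 2 = k.val := by omega
    have hmod : (idxEquiv m (Sum.inl (e, k))).val % 2 = e.val := by omega
    have hfin : ∀ h, (⟨(idxEquiv m (Sum.inl (e, k))).val / 2, h⟩ : Fin (m / 2)) = k :=
      fun h => Fin.ext hdiv
    rw [dif_pos (by omega), hmod, hfin]
    fin_cases e <;> simp
  · have hv : (idxEquiv m (Sum.inr r)).val = m / 2 * 2 + r.val := by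
      simp [idxEquiv]
    rw [dif_neg (by omega)]
    simp
end

section
/- Let F be an algebraically closed field and let w(x_1,…,x_n) be a non-trivial group word. Then the image of the word map w : SL_2(F)^n → SL_2(F) contains every matrix in SL_2(F) whose trace is different from 2 and from −2. -/
namespace WordMapSL2

open Matrix Polynomial

/-- A one-parameter family of matrices of determinant one. -/
def G {R : Type*} [CommRing R] (α β t : R) : Matrix (Fin 2) (Fin 2) R :=
  !![1 + β * t, -t; α * β * t + α - β, 1 - α * t]

lemma G_det {R : Type*} [CommRing R] (α β t : R) : (G α β t).det = 1 := by
  simp [G, Matrix.det_fin_two]; ring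

lemma G_adj {R : Type*} [CommRing R] (α β t : R) : (G α β t).adjugate = G β α (-t) := by
  simp only [G, Matrix.adjugate_fin_two_of]
  ext i j
  fin_cases i <;> fin_cases j <;> simp <;> ring

/-- Leading coefficient of `G α β (s X)`. -/
def lead {F : Type*} [Field F] (α β s : F) : Matrix (Fin 2) (Fin 2) F :=
  !![s * β, -s; s * (α * β), -(s * α)]

/-- Degree bound together with the top coefficient. -/
def Top {F : Type*} [Field F] (M : Matrix (Fin 2) (Fin 2) F[X]) (N : Matrix (Fin 2) (Fin 2) F)
    (k : ℕ) : Prop := ∀ i j, (M i j).natDegree ≤ k ∧ (M i j).coeff k = N i j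

lemma Top.mul {F : Type*} [Field F] {M M' : Matrix (Fin 2) (Fin 2) F[X]}
    {N N' : Matrix (Fin 2) (Fin 2) F} {k k' : ℕ} (h : Top M N k) (h' : Top M' N' k') :
    Top (M * M') (N * N') (k + k') := by
  intro i j
  simp only [Matrix.mul_apply, Fin.sum_univ_two]
  constructor
  · refine (natDegree_add_le_of_degree_le (n := k + k') ?_ ?_)
    · exact natDegree_mul_le_of_le (h _ _).1 (h' _ _).1
    · exact natDegree_mul_le_of_le (h _ _).1 (h' _ _).1
  · rw [coeff_add, coeff_mul_add_eq_of_natDegree_le (h _ _).1 (h' _ _).1,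
      coeff_mul_add_eq_of_natDegree_le (h _ _).1 (h' _ _).1]
    simp [(h _ _).2, (h' _ _).2]

lemma Top_G {F : Type*} [Field F] (α β s : F) :
    Top (G (C α) (C β) (C s * X)) (lead α β s) 1 := by
  intro i j
  constructor
  · fin_cases i <;> fin_cases j <;> simp [G] <;> compute_degree
  · fin_cases i <;> fin_cases j <;>
      simp [G, lead, coeff_one, coeff_C, ← mul_assoc, ← C_mul, -map_mul] <;> ring

/-- Sign of a letter. -/
def sg (F : Type*) [Field F] (b : Bool) : F := cond b 1 (-1)

lemma sg_ne (F : Type*) [Field F] (b : Bool) : sg F b ≠ 0 := by cases b <;> simp [sg]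

/-- Polynomial matrix of a letter. -/
noncomputable def B {F : Type*} [Field F] {ι : Type*} (p : ι × Bool → F) (x : ι × Bool) :
    Matrix (Fin 2) (Fin 2) F[X] :=
  G (C (p x)) (C (p (x.1, !x.2))) (C (sg F x.2) * X)

/-- Leading matrix of a letter. -/
def Ld {F : Type*} [Field F] {ι : Type*} (p : ι × Bool → F) (x : ι × Bool) :
    Matrix (Fin 2) (Fin 2) F :=
  lead (p x) (p (x.1, !x.2)) (sg F x.2)

lemma Top_prod {F : Type*} [Field F] {ι : Type*} (p : ι × Bool → F) (L : List (ι × Bool)) :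
    Top (L.map (B p)).prod (L.map (Ld p)).prod L.length := by
  induction L with
  | nil =>
    intro i j
    fin_cases i <;> fin_cases j <;> simp
  | cons x L ih =>
    simp only [List.map_cons, List.prod_cons, List.length_cons]
    rw [add_comm]
    exact (Top_G _ _ _).mul ih

lemma p_ne {F : Type*} [Field F] {ι : Type*} {p : ι × Bool → F} (hp : Function.Injective p)
    {x y : ι × Bool} (h : x.1 = y.1 → x.2 = y.2) : p (x.1, !x.2) - p y ≠ 0 := by
  intro h0
  have := hp (sub_eq_zero.1 h0)
  obtain ⟨i, b⟩ := x
  obtain ⟨j, c⟩ := y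
  simp at this h
  have h2 := h this.1
  have h3 := this.2
  rw [h2] at h3
  cases c <;> simp at h3

lemma lead_prod {F : Type*} [Field F] {ι : Type*} {p : ι × Bool → F}
    (hp : Function.Injective p) (L : List (ι × Bool)) : ∀ (x : ι × Bool),
    FreeGroup.IsReduced (x :: L) →
    ∃ c : F, c ≠ 0 ∧ ((x :: L).map (Ld p)).prod =
      c • lead (p x) (p ((L.getLastD x).1, !(L.getLastD x).2)) 1 := by
  induction L with
  | nil =>
    intro x _
    refine ⟨sg F x.2, sg_ne _ _, ?_⟩
    simp [Ld, lead]
  | cons y L ih =>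
    intro x h
    rw [FreeGroup.IsReduced, List.isChain_cons_cons] at h
    obtain ⟨c, hc, e⟩ := ih y h.2
    refine ⟨sg F x.2 * (p (x.1, !x.2) - p y) * c,
      mul_ne_zero (mul_ne_zero (sg_ne _ _) (p_ne hp h.1)) hc, ?_⟩
    rw [List.map_cons, List.prod_cons, e]
    rw [List.getLastD_cons]
    ext i j
    fin_cases i <;> fin_cases j <;> simp [Ld, lead, Matrix.mul_apply, Fin.sum_univ_two] <;> ring

/-- The evaluated matrix as an element of `SL_2`. -/
def g {F : Type*} [Field F] (α β t : F) : SpecialLinearGroup (Fin 2) F := ⟨G α β t, G_det _ _ _⟩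

lemma eval_prod {F : Type*} [Field F] {ι : Type*} (p : ι × Bool → F) (t : F)
    (L : List (ι × Bool)) :
    ((FreeGroup.lift (fun i => g (p (i, true)) (p (i, false)) t) (FreeGroup.mk L) :
      SpecialLinearGroup (Fin 2) F) : Matrix (Fin 2) (Fin 2) F) =
      (L.map (B p)).prod.map (Polynomial.eval t) := by
  rw [FreeGroup.lift_mk]
  induction L with
  | nil =>
    ext i j
    fin_cases i <;> fin_cases j <;> simp
  | cons x L ih =>
    rw [List.map_cons, List.prod_cons, List.map_cons, List.prod_cons]
    refine (Matrix.SpecialLinearGroup.coe_mul _ _).trans ?_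
    refine (congrArg (fun Z : Matrix (Fin 2) (Fin 2) F => (_ : Matrix (Fin 2) (Fin 2) F) * Z) ih).trans ?_
    have hmul : ∀ M N : Matrix (Fin 2) (Fin 2) F[X],
        (M * N).map (Polynomial.eval t) = M.map (Polynomial.eval t) * N.map (Polynomial.eval t) :=
      fun M N => Matrix.map_mul (f := Polynomial.evalRingHom t)
    rw [hmul]
    congr 1
    obtain ⟨i, b⟩ := x
    cases b
    · simp only [cond_false, Matrix.SpecialLinearGroup.coe_inv]
      change (G _ _ _).adjugate = _
      rw [G_adj]
      ext i j
      fin_cases i <;> fin_cases j <;> simp [B, G, sg]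
    · change G _ _ _ = _
      ext i j
      fin_cases i <;> fin_cases j <;> simp [B, G, sg]

lemma exists_trace {F : Type*} [Field F] [IsAlgClosed F] {n : ℕ} (L : List (Fin n × Bool))
    (hL : FreeGroup.IsCyclicallyReduced L) (hne : L ≠ []) (τ : F) :
    ∃ a : Fin n → SpecialLinearGroup (Fin 2) F,
      Matrix.trace ((FreeGroup.lift a (FreeGroup.mk L) : SpecialLinearGroup (Fin 2) F) :
        Matrix (Fin 2) (Fin 2) F) = τ := by
  have : Infinite F := IsAlgClosed.instInfinite
  obtain ⟨p⟩ : Nonempty (Fin n × Bool ↪ F) :=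
    ⟨(Finite.equivFin (Fin n × Bool)).toEmbedding.trans
      (Fin.valEmbedding.trans (Infinite.natEmbedding F))⟩
  have hp := p.injective
  set P := (L.map (B p)).prod with hP
  have hT := Top_prod p L
  rw [← hP] at hT
  obtain ⟨x, L', rfl⟩ := List.exists_cons_of_ne_nil hne
  obtain ⟨c, hc, e⟩ := lead_prod hp L' x hL.1
  have hlast : L'.getLastD x ∈ (x :: L').getLast? := by simp [List.getLast?_cons]
  have hcyc := hL.2 _ hlast x (by simp)
  have hcoef : (P.trace - C τ).coeff (x :: L').length ≠ 0 := by
    rw [Matrix.trace_fin_two, coeff_sub, coeff_add, (hT 0 0).2, (hT 1 1).2, e, coeff_C]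
    simp only [List.length_cons, Nat.add_eq_zero_iff, one_ne_zero, and_false, if_false]
    have := mul_ne_zero hc (p_ne hp hcyc)
    intro h0
    apply this
    rw [← h0]
    simp [lead]
    ring
  have hdeg : (P.trace - C τ).degree ≠ 0 := by
    intro h0
    apply hcoef
    apply coeff_eq_zero_of_degree_lt
    rw [h0]
    exact_mod_cast Nat.succ_pos _
  obtain ⟨t, ht⟩ := IsAlgClosed.exists_root _ hdeg
  refine ⟨fun i => g (p (i, true)) (p (i, false)) t, ?_⟩
  rw [eval_prod, ← hP]
  rw [IsRoot, eval_sub, eval_C, sub_eq_zero] at ht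
  rw [← ht, Matrix.trace_fin_two, Matrix.trace_fin_two, eval_add]
  rfl

lemma exists_companion {F : Type*} [Field F] [IsAlgClosed F]
    (A : SpecialLinearGroup (Fin 2) F)
    (hA : Matrix.trace (A : Matrix (Fin 2) (Fin 2) F) ≠ 2)
    (hA' : Matrix.trace (A : Matrix (Fin 2) (Fin 2) F) ≠ -2) :
    ∃ h : SpecialLinearGroup (Fin 2) F, (A : Matrix (Fin 2) (Fin 2) F) * h =
      h * !![0, -1; 1, Matrix.trace (A : Matrix (Fin 2) (Fin 2) F)] := by
  obtain ⟨M, hM⟩ := A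
  simp only at hA hA' ⊢
  rw [Matrix.det_fin_two] at hM
  rw [Matrix.trace_fin_two] at hA hA' ⊢
  generalize ha : M 0 0 = a at *
  generalize hb : M 0 1 = b at *
  generalize hc : M 1 0 = c at *
  generalize hd : M 1 1 = d at *
  have key : ∃ x y : F, c * x ^ 2 + (d - a) * x * y - b * y ^ 2 ≠ 0 := by
    by_contra! hcon
    have h1 := hcon 1 0
    have h2 := hcon 0 1
    have h3 := hcon 1 1
    have hc0 : c = 0 := by simpa using h1
    have hb0 : b = 0 := by simpa using h2
    have hda : d = a := by
      rw [hc0, hb0] at h3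
      linear_combination h3
    subst hc0 hb0 hda
    have : (d - 1) * (d + 1) = 0 := by linear_combination hM
    rcases mul_eq_zero.1 this with h | h
    · exact hA (by linear_combination 2 * h)
    · exact hA' (by linear_combination 2 * h)
  obtain ⟨x, y, hq⟩ := key
  obtain ⟨s, hs⟩ := IsAlgClosed.exists_eq_mul_self
    (c * x ^ 2 + (d - a) * x * y - b * y ^ 2)⁻¹
  have hq1 := inv_mul_cancel₀ hq
  rw [hs] at hq1
  refine ⟨⟨!![s * x, a * (s * x) + b * (s * y); s * y, c * (s * x) + d * (s * y)], ?_⟩, ?_⟩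
  · rw [Matrix.det_fin_two_of]
    linear_combination hq1
  · ext i j
    fin_cases i <;> fin_cases j <;> simp [Matrix.mul_apply, Fin.sum_univ_two, ha, hb, hc, hd]
    · linear_combination (-s * x) * hM
    · linear_combination (-s * y) * hM

lemma conj_of_trace {F : Type*} [Field F] [IsAlgClosed F]
    (A A' : SpecialLinearGroup (Fin 2) F)
    (hA : Matrix.trace (A : Matrix (Fin 2) (Fin 2) F) ≠ 2)
    (hA' : Matrix.trace (A : Matrix (Fin 2) (Fin 2) F) ≠ -2)
    (h : Matrix.trace (A' : Matrix (Fin 2) (Fin 2) F) =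
      Matrix.trace (A : Matrix (Fin 2) (Fin 2) F)) :
    ∃ k : SpecialLinearGroup (Fin 2) F, k * A' * k⁻¹ = A := by
  obtain ⟨u, hu⟩ := exists_companion A hA hA'
  obtain ⟨v, hv⟩ := exists_companion A' (h ▸ hA) (h ▸ hA')
  rw [h] at hv
  let K : SpecialLinearGroup (Fin 2) F :=
    ⟨!![0, -1; 1, Matrix.trace (A : Matrix (Fin 2) (Fin 2) F)], by simp [Matrix.det_fin_two_of]⟩
  have hu' : A * u = u * K := Subtype.ext hu
  have hv' : A' * v = v * K := Subtype.ext hv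
  refine ⟨u * v⁻¹, ?_⟩
  have e1 : A = u * K * u⁻¹ := by rw [← hu']; group
  have e2 : A' = v * K * v⁻¹ := by rw [← hv']; group
  rw [e2, e1]
  group

lemma conj_word {H : Type*} [Group H] {n : ℕ} (x y : FreeGroup (Fin n)) (A : H)
    (a : Fin n → H) (k : H) (hk : k * FreeGroup.lift a y * k⁻¹ = A) :
    ∃ a : Fin n → H, FreeGroup.lift a (x * y * x⁻¹) = A := by
  refine ⟨fun i => MulAut.conj (k * (FreeGroup.lift a x)⁻¹) (a i), ?_⟩
  have hh : FreeGroup.lift (fun i => MulAut.conj (k * (FreeGroup.lift a x)⁻¹) (a i)) =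
      (MulAut.conj (k * (FreeGroup.lift a x)⁻¹)).toMonoidHom.comp (FreeGroup.lift a) := by
    ext1 i
    simp
  rw [hh, ← hk]
  change MulAut.conj (k * (FreeGroup.lift a x)⁻¹) (FreeGroup.lift a (x * y * x⁻¹)) = _
  rw [MulAut.conj_apply, map_mul, map_mul, map_inv]
  group

end WordMapSL2

/-- Let `F` be an algebraically closed field and `w(x_1,…,x_n)` a non-trivial group word.
Then the image of the word map `w : SL_2(F)^n → SL_2(F)` contains every matrix in
`SL_2(F)` whose trace is different from `2` and from `-2`. -/
theorem word_map_surjective_onto_nonparabolic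
    {F : Type*} [Field F] [IsAlgClosed F]
    {n : ℕ} (w : FreeGroup (Fin n)) (hw : w ≠ 1)
    (A : Matrix.SpecialLinearGroup (Fin 2) F)
    (hA : Matrix.trace (A : Matrix (Fin 2) (Fin 2) F) ≠ 2)
    (hA' : Matrix.trace (A : Matrix (Fin 2) (Fin 2) F) ≠ -2) :
    ∃ a : Fin n → Matrix.SpecialLinearGroup (Fin 2) F, FreeGroup.lift a w = A := by
  have hconj := FreeGroup.reduceCyclically.conj_conjugator_reduceCyclically w.toWord
  have hcyc := FreeGroup.reduceCyclically.isCyclicallyReduced (FreeGroup.isReduced_toWord (x := w))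
  set L := FreeGroup.reduceCyclically w.toWord
  set D := FreeGroup.reduceCyclically.conjugator w.toWord
  have hw' : w = FreeGroup.mk D * FreeGroup.mk L * (FreeGroup.mk D)⁻¹ := by
    rw [FreeGroup.inv_mk, FreeGroup.mul_mk, FreeGroup.mul_mk, hconj, FreeGroup.mk_toWord]
  have hne : L ≠ [] := by
    intro h0
    apply hw
    rw [hw', h0, ← FreeGroup.one_eq_mk]
    group
  obtain ⟨a, ha⟩ := WordMapSL2.exists_trace L hcyc hne
    (Matrix.trace (A : Matrix (Fin 2) (Fin 2) F))
  obtain ⟨k, hk⟩ := WordMapSL2.conj_of_trace A _ hA hA' ha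
  rw [hw']
  exact WordMapSL2.conj_word _ _ _ a k hk
end
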